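/- Let U be an even MPO tensor with bond dimension D, in Graded Canonical Form (as an even tensor in the doubled physical index), generating a type I fMPU with antiperiodic boundary conditions. Then there exists k ≤ D⁴ such that for every q ≥ k: r(U_q)·ℓ(U_q) = d^{2q}, and moreover r(U_{q+1}) = d·r(U_q) and ℓ(U_{q+1}) = d·ℓ(U_q). Consequently the exponentiated index √(r(U_q)/ℓ(U_q)) = r(U_q)/d^q is a rational number and is independent of q for q ≥ k. -/

import Mathlib

open Matrix Kronecker
open scoped ComplexOrder

namespace FQCA

noncomputable section

/-- The sign `(-1)^x` associated with a parity `x ∈ ℤ₂`. -/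
def sgn (x : ZMod 2) : ℂ := (-1 : ℂ) ^ x.val

/-- Entrywise complex conjugation of a matrix. -/
def mconj {m n : Type*} (A : Matrix m n ℂ) : Matrix m n ℂ := A.map (starRingEnd ℂ)

/-- A diagonal matrix with diagonal entries `±1`. -/
def IsParityMatrix {ν : Type*} (Z : Matrix ν ν ℂ) : Prop :=
  Z.IsDiag ∧ ∀ α, Z α α = 1 ∨ Z α α = -1

/-- An even tensor: `Z * A i = (-1)^{|i|} A i * Z`. -/
def EvenTensor {ι ν : Type*} [Fintype ν] (p : ι → ZMod 2)
    (A : ι → Matrix ν ν ℂ) (Z : Matrix ν ν ℂ) : Prop :=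
  ∀ i, Z * A i = sgn (p i) • (A i * Z)

/-- The transfer matrix `E_A = Σ_i A^i ⊗ conj (A^i)`. -/
def transfer {ι ν : Type*} [Fintype ι] (A : ι → Matrix ν ν ℂ) :
    Matrix (ν × ν) (ν × ν) ℂ :=
  ∑ i, (A i) ⊗ₖ (mconj (A i))

/-- `P` is the orthogonal projector of a nonzero proper graded invariant subspace for `A`. -/
def GradedInvariantProj {ι ν : Type*} [Fintype ν] [DecidableEq ν]
    (A : ι → Matrix ν ν ℂ) (Z P : Matrix ν ν ℂ) : Prop :=
  P * P = P ∧ Pᴴ = P ∧ P ≠ 0 ∧ P ≠ 1 ∧ P * Z = Z * P ∧ ∀ i, A i * P = P * (A i * P)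

/-- A graded irreducible tensor: no nonzero proper graded invariant subspace. -/
def GradedIrreducible {ι ν : Type*} [Fintype ν] [DecidableEq ν]
    (A : ι → Matrix ν ν ℂ) (Z : Matrix ν ν ℂ) : Prop :=
  ¬ ∃ P, GradedInvariantProj A Z P

/-- A graded normal tensor, `mult = 1` (non-degenerate) or `2` (degenerate):
graded irreducible, `1` is an eigenvalue of the transfer matrix of algebraic multiplicity
`mult`, and all other eigenvalues have modulus `< 1`. -/
def GradedNormal {ι ν : Type*} [Fintype ι] [Fintype ν] [DecidableEq ν]
    (A : ι → Matrix ν ν ℂ) (Z : Matrix ν ν ℂ) (mult : ℕ) : Prop :=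
  GradedIrreducible A Z ∧
  (Matrix.charpoly (transfer A)).rootMultiplicity 1 = mult ∧
  ∀ μ ∈ spectrum ℂ (transfer A), μ ≠ 1 → ‖μ‖ < 1

/-- Graded Canonical Form: `A^i = ⊕ₖ μₖ Aₖ^i` with `Z` block diagonal in the same way and
every block a graded normal tensor. -/
def GCF {ι ν : Type*} [Fintype ι] [Fintype ν] [DecidableEq ν]
    (p : ι → ZMod 2) (A : ι → Matrix ν ν ℂ) (Z : Matrix ν ν ℂ) : Prop :=
  ∃ (g : ℕ) (Dk : Fin g → ℕ) (e : ν ≃ ((k : Fin g) × Fin (Dk k)))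
    (μ : Fin g → ℂ)
    (Ak : (k : Fin g) → ι → Matrix (Fin (Dk k)) (Fin (Dk k)) ℂ)
    (Zk : (k : Fin g) → Matrix (Fin (Dk k)) (Fin (Dk k)) ℂ),
    0 < g ∧
    (∀ i, Matrix.reindex e e (A i) = Matrix.blockDiagonal' (fun k => μ k • Ak k i)) ∧
    Matrix.reindex e e Z = Matrix.blockDiagonal' Zk ∧
    ∀ k, IsParityMatrix (Zk k) ∧ EvenTensor p (Ak k) (Zk k) ∧
      (GradedNormal (Ak k) (Zk k) 1 ∨ GradedNormal (Ak k) (Zk k) 2)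

/-- The coefficient `tr(A^{n₁} ⋯ A^{n_N})` of the fMPS with antiperiodic boundary
conditions generated by the tensor `A`. -/
def mpsCoeff {ι ν : Type*} [Fintype ν] [DecidableEq ν] {N : ℕ}
    (A : ι → Matrix ν ν ℂ) (n : Fin N → ι) : ℂ :=
  ((List.ofFn fun j => A (n j)).prod).trace

/-- The fermionic sign `σ(n,m) = Σ_{k<j} (|n_j|+|m_j|)·|m_k|` of an fMPO matrix element. -/
def mpoSign {ι : Type*} (p : ι → ZMod 2) {N : ℕ} (n m : Fin N → ι) : ZMod 2 :=
  ∑ jk ∈ Finset.univ.filter (fun jk : Fin N × Fin N => jk.2 < jk.1),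
    (p (n jk.1) + p (m jk.1)) * p (m jk.2)

/-- The fMPO with antiperiodic boundary conditions generated by the MPO tensor `U`. -/
def fMPO {ι : Type*} (p : ι → ZMod 2) {ν : Type*} [Fintype ν] [DecidableEq ν]
    (U : ι → ι → Matrix ν ν ℂ) (N : ℕ) :
    Matrix (Fin N → ι) (Fin N → ι) ℂ :=
  Matrix.of fun n m =>
    sgn (mpoSign p n m) * ((List.ofFn fun j => U (n j) (m j)).prod).trace

/-- The fMPO with periodic boundary conditions generated by the MPO tensor `U`
(parity operator `Z` inserted in the trace). -/
def fMPO_PBC {ι : Type*} (p : ι → ZMod 2) {ν : Type*} [Fintype ν] [DecidableEq ν]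
    (Z : Matrix ν ν ℂ) (U : ι → ι → Matrix ν ν ℂ) (N : ℕ) :
    Matrix (Fin N → ι) (Fin N → ι) ℂ :=
  Matrix.of fun n m =>
    sgn (mpoSign p n m) * (Z * (List.ofFn fun j => U (n j) (m j)).prod).trace

/-- The fermionic blocking sign `τ(n,m) = Σ_{j<l} |m_j|·(|n_l|+|m_l|)`. -/
def blockSign {ι : Type*} (p : ι → ZMod 2) {q : ℕ} (n m : Fin q → ι) : ZMod 2 :=
  ∑ jl ∈ Finset.univ.filter (fun jl : Fin q × Fin q => jl.1 < jl.2),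
    p (m jl.1) * (p (n jl.2) + p (m jl.2))

/-- The `q`-fold blocked MPO tensor, with the fermionic blocking signs. -/
def blocked {ι : Type*} (p : ι → ZMod 2) {ν : Type*} [Fintype ν] [DecidableEq ν]
    (U : ι → ι → Matrix ν ν ℂ) (q : ℕ) :
    (Fin q → ι) → (Fin q → ι) → Matrix ν ν ℂ :=
  fun n m => sgn (blockSign p n m) • ((List.ofFn fun j => U (n j) (m j)).prod)

/-- The right rank `r(U)`: rank of the matrix with entry
`(-1)^{|n||m|} (U^{n,m})_{α,β}` in row `(n,β)` and column `(m,α)`. -/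
def rightRank {ι ν : Type*} [Fintype ι] [Fintype ν]
    (p : ι → ZMod 2) (U : ι → ι → Matrix ν ν ℂ) : ℕ :=
  (Matrix.of fun (r c : ι × ν) => sgn (p r.1 * p c.1) * U r.1 c.1 c.2 r.2).rank

/-- The left rank `ℓ(U)`: rank of the matrix with entry `(U^{n,m})_{α,β}`
in row `(n,α)` and column `(m,β)`. -/
def leftRank {ι ν : Type*} [Fintype ι] [Fintype ν]
    (U : ι → ι → Matrix ν ν ℂ) : ℕ :=
  (Matrix.of fun (r c : ι × ν) => U r.1 c.1 r.2 c.2).rank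

/-- The Pauli matrix `σˣ`, indexed by `Bool`. -/
def pauliX : Matrix Bool Bool ℂ := Matrix.of fun a b => if a = b then 0 else 1

/-- The Pauli matrix `σᶻ`, indexed by `Bool`. -/
def pauliZ : Matrix Bool Bool ℂ := Matrix.diagonal (fun b => if b then -1 else 1)

/-- The single-site physical parity matrix `P = diag((-1)^{|i|})`. -/
def singleP {ι : Type*} [DecidableEq ι] (p : ι → ZMod 2) : Matrix ι ι ℂ :=
  Matrix.diagonal (fun i => sgn (p i))

/-- The parity of the doubled physical index `(n,m)` of an MPO tensor. -/
def doubledP {ι : Type*} (p : ι → ZMod 2) : ι × ι → ZMod 2 :=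
  fun nm => p nm.1 + p nm.2

/-- An MPO tensor regarded as a tensor in the doubled physical index. -/
def doubledT {ι ν : Type*} (U : ι → ι → Matrix ν ν ℂ) : ι × ι → Matrix ν ν ℂ :=
  fun nm => U nm.1 nm.2

/-- An MPO tensor rescaled by `c`, regarded as a tensor in the doubled physical index. -/
def mpoScaled {ι ν : Type*} (c : ℂ) (U : ι → ι → Matrix ν ν ℂ) : ι × ι → Matrix ν ν ℂ :=
  fun nm => c • U nm.1 nm.2

/-- The parity operator `σᶻ ⊗ I` on the bond space `Bool × Fin b`. -/
def ZBP (b : ℕ) : Matrix (Bool × Fin b) (Bool × Fin b) ℂ :=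
  pauliZ ⊗ₖ (1 : Matrix (Fin b) (Fin b) ℂ)

/-- Structure of a type II MPO tensor: `U^{n,m} = (σˣ)^{|n|+|m|} ⊗ N^{n,m}`. -/
def TypeIIStruct {d b : ℕ} (p : Fin d → ZMod 2)
    (U : Fin d → Fin d → Matrix (Bool × Fin b) (Bool × Fin b) ℂ) : Prop :=
  ∃ Nm : Fin d → Fin d → Matrix (Fin b) (Fin b) ℂ,
    ∀ n m', U n m' = (pauliX ^ (p n + p m').val) ⊗ₖ Nm n m'

/-- The parity matrix of the product grading on `q` sites. -/
def bigP {d : ℕ} (p : Fin d → ZMod 2) (q : ℕ) :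
    Matrix (Fin q → Fin d) (Fin q → Fin d) ℂ :=
  Matrix.diagonal (fun n => sgn (∑ i, p (n i)))

/-- The Jordan-Wigner embedding at site `j` of a local operator `O` homogeneous of
parity `o`: `P^{|O|} ⊗ ⋯ ⊗ P^{|O|} ⊗ O ⊗ I ⊗ ⋯ ⊗ I`. -/
def jordanWigner {d N : ℕ} (p : Fin d → ZMod 2) (o : ZMod 2)
    (O : Matrix (Fin d) (Fin d) ℂ) (j : Fin N) :
    Matrix (Fin N → Fin d) (Fin N → Fin d) ℂ :=
  Matrix.of fun n m =>
    (∏ l ∈ Finset.univ.filter (fun l : Fin N => l < j),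
      ((singleP p) ^ o.val) (n l) (m l)) *
    O (n j) (m j) *
    (∏ l ∈ Finset.univ.filter (fun l : Fin N => j < l),
      (if n l = m l then (1:ℂ) else 0))

/-- The right rank of the `q`-fold blocked MPO tensor. -/
def rrBlocked {d D : ℕ} (p : Fin d → ZMod 2)
    (U : Fin d → Fin d → Matrix (Fin D) (Fin D) ℂ) (q : ℕ) : ℕ :=
  rightRank (fun n : Fin q → Fin d => ∑ j, p (n j)) (blocked p U q)

/-- The left rank of the `q`-fold blocked MPO tensor. -/
def llBlocked {d D : ℕ} (p : Fin d → ZMod 2)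
    (U : Fin d → Fin d → Matrix (Fin D) (Fin D) ℂ) (q : ℕ) : ℕ :=
  leftRank (blocked p U q)

section LinearAlgebra

variable {h : Type*} [Fintype h] [DecidableEq h]

/-- An idempotent matrix of trace zero vanishes. -/
lemma eq_zero_of_idempotent_of_trace_eq_zero {A : Matrix h h ℂ} (hA : A * A = A)
    (ht : A.trace = 0) : A = 0 := by
  have hid : IsIdempotentElem (Matrix.toLin' A) := by
    rw [IsIdempotentElem, Module.End.mul_eq_comp, ← Matrix.toLin'_mul, hA]
  have := LinearMap.IsIdempotentElem.eq_zero_of_trace_eq_zero hid (by rw [Matrix.trace_toLin'_eq, ht])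
  simpa using this

/-- The rank of an idempotent matrix is its trace. -/
lemma rank_eq_trace_of_idempotent {A : Matrix h h ℂ} (hA : A * A = A) :
    (A.rank : ℂ) = A.trace := by
  have hid : IsIdempotentElem (Matrix.toLin' A) := by
    rw [IsIdempotentElem, Module.End.mul_eq_comp, ← Matrix.toLin'_mul, hA]
  rw [← Matrix.trace_toLin'_eq, (LinearMap.IsIdempotentElem.isProj_range _ hid).trace,
    Matrix.rank, Matrix.toLin'_apply']

/-- A matrix of rank `r` factors through `Fin r`, with factors having one-sided inverses. -/
lemma exists_rank_factorization {m n : Type*} [Fintype m] [DecidableEq m] [Fintype n]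
    [DecidableEq n] (A : Matrix m n ℂ) {k : ℕ} (hA : A.rank = k) :
    ∃ (C : Matrix m (Fin k) ℂ) (F : Matrix (Fin k) n ℂ) (G : Matrix (Fin k) m ℂ)
      (H : Matrix n (Fin k) ℂ), A = C * F ∧ G * C = 1 ∧ F * H = 1 := by
  let f : (n → ℂ) →ₗ[ℂ] (m → ℂ) := A.mulVecLin
  have hr : Module.finrank ℂ f.range = Module.finrank ℂ (Fin k → ℂ) := by
    rw [Module.finrank_fin_fun, ← hA]; rfl
  let e : f.range ≃ₗ[ℂ] (Fin k → ℂ) := LinearEquiv.ofFinrankEq _ _ hr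
  let c : (Fin k → ℂ) →ₗ[ℂ] (m → ℂ) := f.range.subtype ∘ₗ e.symm.toLinearMap
  let g : (n → ℂ) →ₗ[ℂ] (Fin k → ℂ) := e.toLinearMap ∘ₗ f.rangeRestrict
  obtain ⟨c', hc'⟩ := c.exists_leftInverse_of_injective
    (LinearMap.ker_eq_bot.2 (f.range.injective_subtype.comp e.symm.injective))
  obtain ⟨g', hg'⟩ := g.exists_rightInverse_of_surjective
    (LinearMap.range_eq_top.2 (e.surjective.comp f.surjective_rangeRestrict))
  refine ⟨LinearMap.toMatrix' c, LinearMap.toMatrix' g, LinearMap.toMatrix' c',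
    LinearMap.toMatrix' g', ?_, ?_, ?_⟩
  · rw [← LinearMap.toMatrix'_comp]
    have : c ∘ₗ g = f := by
      ext v
      simp [c, g]
    rw [this]
    exact (LinearMap.toMatrix'_toLin' A).symm
  · rw [← LinearMap.toMatrix'_comp, hc', LinearMap.toMatrix'_id]
  · rw [← LinearMap.toMatrix'_comp, hg', LinearMap.toMatrix'_id]

lemma exists_eq_vecMulVec_of_rank_eq_one {m n : Type*} [Fintype m] [DecidableEq m] [Fintype n]
    [DecidableEq n] {A : Matrix m n ℂ} (hA : A.rank = 1) : ∃ r s, A = vecMulVec r s := by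
  obtain ⟨C, F, -, -, hCF, -, -⟩ := exists_rank_factorization A hA
  refine ⟨fun i => C i 0, fun j => F 0 j, ?_⟩
  ext i j
  rw [hCF, Matrix.mul_apply, Fintype.sum_unique, vecMulVec_apply]
  rfl

/-- The rank is at least `r` if the matrix can be multiplied into the identity of size `r`. -/
lemma card_le_rank_of_mul_mul_eq_one {l m n : Type*} [Fintype l] [DecidableEq l] [Fintype m]
    [DecidableEq m] [Fintype n] [DecidableEq n] {A : Matrix m n ℂ} {G : Matrix l m ℂ}
    {H : Matrix n l ℂ} (hA : G * A * H = 1) : Fintype.card l ≤ A.rank := by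
  rw [← Matrix.rank_one (R := ℂ) (n := l), ← hA]
  exact (Matrix.rank_mul_le_left _ _).trans (Matrix.rank_mul_le_right _ _)

/-- The rank is multiplicative under Kronecker products. -/
lemma rank_kronecker {l m n o : Type*} [Fintype l] [DecidableEq l] [Fintype m] [DecidableEq m]
    [Fintype n] [DecidableEq n] [Fintype o] [DecidableEq o] (A : Matrix l m ℂ)
    (B : Matrix n o ℂ) : (A ⊗ₖ B).rank = A.rank * B.rank := by
  obtain ⟨C, F, G, H, hA, hG, hH⟩ := exists_rank_factorization A rfl
  obtain ⟨C', F', G', H', hB, hG', hH'⟩ := exists_rank_factorization B rfl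
  have hAB : A ⊗ₖ B = (C ⊗ₖ C') * (F ⊗ₖ F') := by
    rw [← Matrix.mul_kronecker_mul, ← hA, ← hB]
  have hcard : Fintype.card (Fin A.rank × Fin B.rank) = A.rank * B.rank := by simp
  refine le_antisymm ?_ ?_
  · conv_lhs => rw [hAB]
    rw [← hcard]
    exact (Matrix.rank_mul_le_left _ _).trans (Matrix.rank_le_card_width _)
  · rw [← hcard]
    refine card_le_rank_of_mul_mul_eq_one (G := G ⊗ₖ G') (H := H ⊗ₖ H') ?_
    rw [hAB, ← Matrix.mul_assoc, Matrix.mul_assoc, ← Matrix.mul_kronecker_mul,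
      ← Matrix.mul_kronecker_mul, hG, hG', hH, hH', Matrix.one_kronecker_one, mul_one]

/-- A complex matrix all of whose positive powers are traceless is nilpotent. -/
lemma isNilpotent_of_trace_pow_eq_zero {A : Matrix h h ℂ}
    (hA : ∀ k : ℕ, 1 ≤ k → (A ^ k).trace = 0) : IsNilpotent A := by
  obtain ⟨g, hg, hnd⟩ := Polynomial.exists_eq_pow_rootMultiplicity_mul_and_not_dvd
    A.charpoly A.charpoly_monic.ne_zero 0
  set a := A.charpoly.rootMultiplicity 0
  simp only [map_zero, sub_zero] at hg hnd
  have hcop : IsCoprime ((Polynomial.X : Polynomial ℂ) ^ (a + 1)) g :=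
    IsCoprime.pow_left ((Polynomial.irreducible_X.coprime_iff_not_dvd).2 hnd)
  obtain ⟨u, v, huv⟩ := hcop
  have h0 : A ^ (a + 1) * Polynomial.aeval A g = 0 := by
    have := Matrix.aeval_self_charpoly A
    rw [hg, map_mul, map_pow, Polynomial.aeval_X] at this
    rw [pow_succ', mul_assoc, this, mul_zero]
  set e := Polynomial.aeval A (u * Polynomial.X ^ (a + 1)) with he
  set f := Polynomial.aeval A (v * g) with hf
  have hef : e + f = 1 := by rw [he, hf, ← map_add, huv, map_one]
  have hmul : A ^ (a + 1) * f = 0 := by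
    rw [hf, mul_comm v g, map_mul, ← mul_assoc, h0, zero_mul]
  have heq : e = Polynomial.aeval A u * A ^ (a + 1) := by
    rw [he, map_mul, map_pow, Polynomial.aeval_X]
  have hef0 : e * f = 0 := by rw [heq, mul_assoc, hmul, mul_zero]
  have hee : e * e = e := by
    calc e * e = e * (e + f) := by rw [mul_add, hef0, add_zero]
      _ = e := by rw [hef, mul_one]
  have htr : e.trace = 0 := by
    have : ∀ w : Polynomial ℂ, (Polynomial.aeval A w * A ^ (a + 1)).trace = 0 := by
      intro w
      induction w using Polynomial.induction_on' with
      | add p q hp hq => rw [map_add, add_mul, Matrix.trace_add, hp, hq, add_zero]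
      | monomial n c =>
        rw [Polynomial.aeval_monomial, mul_assoc, ← pow_add, ← Algebra.smul_def,
          Matrix.trace_smul, hA _ (by omega), smul_zero]
    rw [heq, this]
  have he0 := eq_zero_of_idempotent_of_trace_eq_zero hee htr
  refine ⟨a + 1, ?_⟩
  rw [← mul_one (A ^ (a + 1)), ← hef, he0, zero_add, hmul]

attribute [local instance] LieRing.ofAssociativeRing

/-- In an algebra of nilpotent matrices every product of at least `card h` factors vanishes. -/
lemma list_prod_eq_zero_of_nil (K : Submodule ℂ (Matrix h h ℂ))
    (hmul : ∀ a ∈ K, ∀ b ∈ K, a * b ∈ K) (hnil : ∀ a ∈ K, IsNilpotent a)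
    (l : List (Matrix h h ℂ)) (hl : ∀ a ∈ l, a ∈ K) (hlen : Fintype.card h ≤ l.length) :
    l.prod = 0 := by
  let L : LieSubalgebra ℂ (Matrix h h ℂ) :=
    { K with
      lie_mem' := fun {x y} hx hy => by
        rw [Ring.lie_def]
        exact K.sub_mem (hmul _ hx _ hy) (hmul _ hy _ hx) }
  have hN : LieModule.IsNilpotent L (h → ℂ) := by
    rw [LieModule.isNilpotent_iff_forall (R := ℂ)]
    rintro ⟨x, hx⟩
    have : LieModule.toEnd ℂ L (h → ℂ) ⟨x, hx⟩ = Matrix.toLin' x := by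
      ext; simp
    rw [this]
    exact (hnil x hx).map Matrix.toLinAlgEquiv'
  let S : ℕ → LieSubmodule ℂ L (h → ℂ) := LieModule.lowerCentralSeries ℂ L (h → ℂ)
  have hanti : Antitone S := LieModule.antitone_lowerCentralSeries ℂ L (h → ℂ)
  have hbot : S (Fintype.card h) = ⊥ := by
    obtain ⟨m, hm⟩ := (LieModule.isNilpotent_iff ℂ L (h → ℂ)).1 hN
    have key : ∀ j, S j = ⊥ ∨
        Module.finrank ℂ (S j).toSubmodule + j ≤ Fintype.card h := by
      intro j
      induction j with
      | zero =>
        right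
        simpa using Submodule.finrank_le (S 0).toSubmodule
      | succ j ih =>
        rcases ih with ih | ih
        · left
          exact le_bot_iff.1 (ih ▸ hanti (Nat.le_succ j))
        · by_cases hs : S (j + 1) = S j
          · left
            have hst : ∀ i, S (j + i) = S j := by
              intro i
              induction i with
              | zero => rfl
              | succ i ih2 =>
                rw [← add_assoc]
                have h1 := LieModule.lowerCentralSeries_succ ℂ L (h → ℂ) (j + i)
                have h2 := LieModule.lowerCentralSeries_succ ℂ L (h → ℂ) j
                change S (j + i + 1) = ⁅⊤, S (j + i)⁆ at h1
                change S (j + 1) = ⁅⊤, S j⁆ at h2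
                rw [h1, ih2, ← h2, hs]
            rw [hs, ← hst m]
            exact le_bot_iff.1 ((hanti (Nat.le_add_left m j)).trans_eq hm)
          · right
            have hlt : (S (j + 1)).toSubmodule < (S j).toSubmodule :=
              lt_of_le_of_ne (hanti (Nat.le_succ j)) (fun h => hs (by
                rwa [LieSubmodule.toSubmodule_inj] at h))
            have := Submodule.finrank_lt_finrank_of_lt hlt
            omega
    rcases key (Fintype.card h) with hk | hk
    · exact hk
    · have : Module.finrank ℂ (S (Fintype.card h)).toSubmodule = 0 := by omega
      rw [Submodule.finrank_eq_zero] at this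
      rwa [LieSubmodule.toSubmodule_eq_bot] at this
  have hmem : ∀ (l : List (Matrix h h ℂ)), (∀ a ∈ l, a ∈ K) → ∀ v : h → ℂ,
      l.prod *ᵥ v ∈ S l.length := by
    intro l
    induction l with
    | nil => intro _ v; exact LieSubmodule.mem_top _
    | cons a l ih =>
      intro hl v
      have h1 := LieModule.lowerCentralSeries_succ ℂ L (h → ℂ) l.length
      change S (l.length + 1) = ⁅⊤, S l.length⁆ at h1
      rw [List.prod_cons, ← Matrix.mulVec_mulVec, List.length_cons, h1]
      exact LieSubmodule.lie_mem_lie (x := (⟨a, hl a (by simp)⟩ : L)) (LieSubmodule.mem_top _)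
        (ih (fun b hb => hl b (by simp [hb])) v)
  apply Matrix.toLin'.injective
  ext1 v
  have := (hanti hlen) (hmem l hl (Pi.single v 1))
  rw [hbot, LieSubmodule.mem_bot] at this
  ext i
  simpa using congrFun this i

end LinearAlgebra

section TraceMultiplicative

set_option linter.unusedSectionVars false

variable {h : Type*} [Fintype h] [DecidableEq h]

/-- A subspace of matrices closed under multiplication, on which the trace is multiplicative. -/
structure IsTraceMul (A : Submodule ℂ (Matrix h h ℂ)) : Prop where
  mul_mem : ∀ a ∈ A, ∀ b ∈ A, a * b ∈ A
  trace_mul : ∀ a ∈ A, ∀ b ∈ A, (a * b).trace = a.trace * b.trace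

namespace IsTraceMul

variable {A : Submodule ℂ (Matrix h h ℂ)}

lemma pow_mem (hA : IsTraceMul A) {a : Matrix h h ℂ} (ha : a ∈ A) (k : ℕ) :
    a ^ (k + 1) ∈ A ∧ (a ^ (k + 1)).trace = a.trace ^ (k + 1) := by
  induction k with
  | zero => simpa using ha
  | succ k ih =>
    rw [pow_succ a (k + 1)]
    exact ⟨hA.mul_mem _ ih.1 _ ha, by rw [hA.trace_mul _ ih.1 _ ha, ih.2, ← pow_succ]⟩

lemma isNilpotent (hA : IsTraceMul A) {a : Matrix h h ℂ} (ha : a ∈ A) (ht : a.trace = 0) :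
    IsNilpotent a := by
  refine isNilpotent_of_trace_pow_eq_zero fun k hk => ?_
  obtain ⟨k, rfl⟩ := Nat.exists_eq_add_of_le' hk
  rw [(hA.pow_mem ha k).2, ht, zero_pow (by omega)]

lemma mul_mul_eq_trace_smul (hA : IsTraceMul A) {r s : h → ℂ} (hP : vecMulVec r s ∈ A)
    (hrs : s ⬝ᵥ r = 1) {a : Matrix h h ℂ} (ha : a ∈ A) :
    vecMulVec r s * a * vecMulVec r s = a.trace • vecMulVec r s := by
  have h1 : (a * vecMulVec r s).trace = s ⬝ᵥ (a *ᵥ r) := by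
    rw [Matrix.mul_vecMulVec, Matrix.trace_vecMulVec, dotProduct_comm]
  have h2 : (vecMulVec r s).trace = 1 := by
    rw [Matrix.trace_vecMulVec, dotProduct_comm, hrs]
  rw [hA.trace_mul _ ha _ hP, h2, mul_one] at h1
  rw [mul_assoc, Matrix.mul_vecMulVec, Matrix.vecMulVec_mul_vecMulVec, h1]
  ext i j
  simp [vecMulVec_apply]
  ring

/-- A trace-one element has a power that is a rank-one projector. -/
lemma exists_pow_eq_vecMulVec (hA : IsTraceMul A) {E : Matrix h h ℂ} (hE : E ∈ A)
    (ht : E.trace = 1) : ∃ (N : ℕ) (r s : h → ℂ), E ^ (N + 1) = vecMulVec r s ∧ s ⬝ᵥ r = 1 ∧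
      vecMulVec r s ∈ A ∧ E * vecMulVec r s = vecMulVec r s := by
  have hmem2 := hA.mul_mem _ hE _ hE
  obtain ⟨n, hn⟩ := hA.isNilpotent (A.sub_mem hmem2 hE)
    (by rw [Matrix.trace_sub, hA.trace_mul _ hE _ hE, ht]; ring)
  replace hn : (E * E - E) ^ (n + 1) = 0 := by rw [pow_succ, hn, zero_mul]
  have hpoly : ∀ w : Polynomial ℂ, Polynomial.aeval E (Polynomial.X * w) ∈ A ∧
      (Polynomial.aeval E (Polynomial.X * w)).trace = w.eval 1 := by
    intro w
    induction w using Polynomial.induction_on' with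
    | add p q hp hq =>
      rw [mul_add, map_add, Matrix.trace_add, Polynomial.eval_add, hp.2, hq.2]
      exact ⟨A.add_mem hp.1 hq.1, rfl⟩
    | monomial k c =>
      rw [Polynomial.X_mul_monomial, Polynomial.aeval_monomial, ← Algebra.smul_def,
        Matrix.trace_smul, (hA.pow_mem hE k).2, ht]
      exact ⟨A.smul_mem _ (hA.pow_mem hE k).1, by simp⟩
  set p : Polynomial ℂ := 1 - (1 - Polynomial.X ^ (n + 1)) ^ (n + 1) with hp
  have hXp : (Polynomial.X : Polynomial ℂ) ^ (n + 1) ∣ p := by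
    have := sub_dvd_pow_sub_pow (1 : Polynomial ℂ) (1 - Polynomial.X ^ (n + 1)) (n + 1)
    simpa using this
  have hYf : ((Polynomial.X : Polynomial ℂ) - 1) ^ (n + 1) ∣ 1 - p := by
    rw [hp, sub_sub_cancel]
    refine pow_dvd_pow_of_dvd ?_ _
    have := sub_dvd_pow_sub_pow (Polynomial.X : Polynomial ℂ) 1 (n + 1)
    rw [one_pow] at this
    rw [← neg_sub (Polynomial.X ^ (n + 1) : Polynomial ℂ) 1]
    exact (dvd_neg).2 this
  set P := Polynomial.aeval E p with hPdef
  have hPid : P * P = P := by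
    obtain ⟨c, hc⟩ := mul_dvd_mul hXp hYf
    have h1 : Polynomial.aeval E (p * (1 - p)) = 0 := by
      rw [hc, ← mul_pow, map_mul, map_pow, map_mul, map_sub, Polynomial.aeval_X, map_one,
        mul_sub, mul_one, hn, zero_mul]
    rw [mul_sub, mul_one, map_sub, map_mul, sub_eq_zero] at h1
    exact h1.symm
  obtain ⟨c, hc⟩ := (dvd_pow_self (Polynomial.X : Polynomial ℂ) (Nat.succ_ne_zero n)).trans hXp
  have hPA : P ∈ A := by rw [hPdef, hc]; exact (hpoly c).1
  have hPt : P.trace = 1 := by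
    rw [hPdef, hc, (hpoly c).2]
    have := congrArg (Polynomial.eval 1) hc
    simp only [hp, Polynomial.eval_sub, Polynomial.eval_one, Polynomial.eval_pow,
      Polynomial.eval_X, Polynomial.eval_mul, one_pow, sub_self, one_mul] at this
    rw [← this, zero_pow (by omega), sub_zero]
  have hrank : P.rank = 1 := by
    have := rank_eq_trace_of_idempotent hPid
    rw [hPt] at this
    exact_mod_cast this
  obtain ⟨r, s, hrs⟩ : ∃ r s : h → ℂ, P = vecMulVec r s :=
    exists_eq_vecMulVec_of_rank_eq_one hrank
  have hsr : s ⬝ᵥ r = 1 := by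
    rw [dotProduct_comm, ← Matrix.trace_vecMulVec, ← hrs, hPt]
  have hcomm : E * P = P * E := by
    have : Polynomial.aeval E (Polynomial.X * p) = Polynomial.aeval E (p * Polynomial.X) := by
      rw [mul_comm]
    simpa using this
  have hEP : E * P = P := by
    have h1 := hA.mul_mul_eq_trace_smul (hrs ▸ hPA) hsr hE
    rw [← hrs, ht, one_smul, ← hcomm, mul_assoc, hPid] at h1
    exact h1
  obtain ⟨m, hm⟩ := hA.isNilpotent (A.sub_mem hE hPA)
    (by rw [Matrix.trace_sub, ht, hPt, sub_self])
  have hpow : ∀ j, E ^ (j + 1) = P + (E - P) ^ (j + 1) := by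
    intro j
    induction j with
    | zero => simp
    | succ j ih =>
      have h0 : P * (E - P) ^ (j + 1) = 0 := by
        rw [pow_succ', ← mul_assoc, mul_sub, ← hcomm, hEP, hPid, sub_self, zero_mul]
      rw [pow_succ' E (j + 1), ih, mul_add, hEP, pow_succ' (E - P) (j + 1), sub_mul, h0, sub_zero]
  refine ⟨m, r, s, ?_, hsr, hrs ▸ hPA, ?_⟩
  · rw [hpow, pow_succ, hm, zero_mul, add_zero, hrs]
  · rw [← hrs, hEP]

/-- Long products decouple across the rank-one projector. -/
lemma prod_mul_one_sub_mul_prod (hA : IsTraceMul A) {r s : h → ℂ} (hP : vecMulVec r s ∈ A)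
    (hrs : s ⬝ᵥ r = 1) {l₁ l₂ : List (Matrix h h ℂ)} (h₁ : ∀ a ∈ l₁, a ∈ A)
    (h₂ : ∀ a ∈ l₂, a ∈ A) (hl₁ : Fintype.card h ≤ l₁.length)
    (hl₂ : Fintype.card h ≤ l₂.length) :
    l₁.prod * (1 - vecMulVec r s) * l₂.prod = 0 := by
  set P := vecMulVec r s with hPdef
  have hPt : P.trace = 1 := by rw [hPdef, Matrix.trace_vecMulVec, dotProduct_comm, hrs]
  have hPaP : ∀ a ∈ A, P * a * P = a.trace • P := fun a ha => hA.mul_mul_eq_trace_smul hP hrs ha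
  have hPP : P * P = P := by
    rw [hPdef, Matrix.vecMulVec_mul_vecMulVec, hrs]
    ext i j; simp [vecMulVec_apply]
  let K : Submodule ℂ (Matrix h h ℂ) := A ⊓ LinearMap.ker (Matrix.traceLinearMap h ℂ ℂ)
  have hK : ∀ a, a ∈ K ↔ a ∈ A ∧ a.trace = 0 := fun a => by simp [K]
  have hKmul : ∀ a ∈ K, ∀ b ∈ K, a * b ∈ K := by
    intro a ha b hb
    rw [hK] at *
    exact ⟨hA.mul_mem _ ha.1 _ hb.1, by rw [hA.trace_mul _ ha.1 _ hb.1, ha.2, zero_mul]⟩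
  have hKnil : ∀ a ∈ K, IsNilpotent a := fun a ha =>
    hA.isNilpotent ((hK a).1 ha).1 ((hK a).1 ha).2
  have hPKP : ∀ k ∈ K, P * k * P = 0 := fun k hk => by
    rw [hPaP k ((hK k).1 hk).1, ((hK k).1 hk).2, zero_smul]
  have hKf : ∀ k ∈ K, ∀ k' ∈ K, k * (1 - P) * k' ∈ K := by
    intro k hk k' hk'
    rw [mul_sub, mul_one, sub_mul]
    refine K.sub_mem (hKmul k hk k' hk') ?_
    have hk1 := (hK k).1 hk
    have hk1' := (hK k').1 hk'
    refine (hK _).2 ⟨hA.mul_mem _ (hA.mul_mem _ hk1.1 _ hP) _ hk1'.1, ?_⟩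
    rw [hA.trace_mul _ (hA.mul_mem _ hk1.1 _ hP) _ hk1'.1, hk1'.2, mul_zero]
  have hPkfP : ∀ k ∈ K, P * k * (1 - P) * P = 0 := fun k hk => by
    rw [mul_assoc _ (1 - P), sub_mul, one_mul, hPP, sub_self, mul_zero]
  have hsplit : ∀ a ∈ A, ∃ k ∈ K, a = a.trace • P + k := by
    intro a ha
    refine ⟨a - a.trace • P, (hK _).2 ⟨A.sub_mem ha (A.smul_mem _ hP), ?_⟩, by abel⟩
    rw [Matrix.trace_sub, Matrix.trace_smul, hPt, smul_eq_mul, mul_one, sub_self]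
  -- the tail of a product starting from its last passage through `P`
  let T : Set (Matrix h h ℂ) := {t | ∀ k ∈ K, P * k * (1 - P) * t = 0}
  have hKT : ∀ k ∈ K, ∀ t ∈ T, k * (1 - P) * t ∈ T := by
    intro k hk t ht k' hk'
    calc P * k' * (1 - P) * (k * (1 - P) * t)
        = P * (k' * (1 - P) * k) * (1 - P) * t := by noncomm_ring
      _ = 0 := ht _ (hKf _ hk' _ hk)
  have hKT' : ∀ k ∈ K, ∀ t ∈ T, k * t ∈ T := by
    intro k hk t ht k' hk'
    have h1 : P * k' * (1 - P) * (k * t) = P * (k' * (1 - P) * k) * P * t +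
        P * (k' * (1 - P) * k) * (1 - P) * t := by noncomm_ring
    rw [h1, hPKP _ (hKf _ hk' _ hk), ht _ (hKf _ hk' _ hk), zero_mul, add_zero]
  have hright : ∀ l : List (Matrix h h ℂ), (∀ a ∈ l, a ∈ A) → ∃ l' : List (Matrix h h ℂ),
      l'.length = l.length ∧ (∀ a ∈ l', a ∈ K) ∧ l.prod - l'.prod ∈ T := by
    intro l
    induction l with
    | nil => intro _; exact ⟨[], rfl, by simp, fun k _ => by simp⟩
    | cons a l ih =>
      intro hl
      obtain ⟨l', hlen, hl', ht⟩ := ih (fun b hb => hl b (by simp [hb]))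
      obtain ⟨k, hk, hak⟩ := hsplit a (hl a (by simp))
      refine ⟨k :: l', by simp [hlen], by simpa using ⟨hk, hl'⟩, fun k' hk' => ?_⟩
      have h1 : (a :: l).prod - (k :: l').prod =
          a.trace • (P * l.prod) + k * (l.prod - l'.prod) := by
        rw [List.prod_cons, List.prod_cons]
        nth_rewrite 1 [hak]
        rw [add_mul, smul_mul_assoc]
        noncomm_ring
      rw [h1, mul_add, hKT' k hk _ ht k' hk', add_zero, mul_smul_comm, ← mul_assoc,
        hPkfP k' hk', zero_mul, smul_zero]
  have hb : l₂.prod ∈ T := by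
    obtain ⟨l', hlen, hl', ht⟩ := hright l₂ h₂
    rwa [list_prod_eq_zero_of_nil K hKmul hKnil l' hl' (by omega), sub_zero] at ht
  have hleft : ∀ l : List (Matrix h h ℂ), (∀ a ∈ l, a ∈ A) → ∃ l' : List (Matrix h h ℂ),
      l'.length = l.length ∧ (∀ a ∈ l', a ∈ K) ∧
        ∀ t ∈ T, (l.prod - l'.prod) * (1 - P) * t = 0 := by
    intro l
    induction l using List.reverseRecOn with
    | nil => intro _; exact ⟨[], rfl, by simp, fun k _ => by simp⟩
    | append_singleton l a ih =>
      intro hl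
      obtain ⟨l', hlen, hl', ht⟩ := ih (fun b hb => hl b (by simp [hb]))
      obtain ⟨k, hk, hak⟩ := hsplit a (hl a (by simp))
      refine ⟨l' ++ [k], by simp [hlen], ?_, fun t htT => ?_⟩
      · intro b hb
        rcases List.mem_append.1 hb with hb | hb
        · exact hl' b hb
        · rw [List.mem_singleton.1 hb]; exact hk
      have h1 : ((l ++ [a]).prod - (l' ++ [k]).prod) * (1 - P) * t =
          a.trace • (l.prod * (P * (1 - P)) * t) + ((l.prod - l'.prod) * (P * k * (1 - P) * t) +
            (l.prod - l'.prod) * (1 - P) * (k * (1 - P) * t)) := by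
        rw [List.prod_append, List.prod_append, List.prod_singleton, List.prod_singleton]
        nth_rewrite 1 [hak]
        rw [mul_add, mul_smul_comm, add_sub_assoc, add_mul, add_mul, smul_mul_assoc,
          smul_mul_assoc]
        noncomm_ring
      rw [h1, htT k hk, ht _ (hKT k hk t htT), mul_sub, mul_one, hPP, sub_self]
      simp
  obtain ⟨l', hlen, hl', ht⟩ := hleft l₁ h₁
  have := ht _ hb
  rwa [list_prod_eq_zero_of_nil K hKmul hKnil l' hl' (by omega), sub_zero] at this

/-- The span of a multiplicatively closed set on which the trace is multiplicative is a
trace-multiplicative algebra. -/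
lemma span {S : Set (Matrix h h ℂ)} (hmul : ∀ a ∈ S, ∀ b ∈ S, a * b ∈ S)
    (htr : ∀ a ∈ S, ∀ b ∈ S, (a * b).trace = a.trace * b.trace) :
    IsTraceMul (Submodule.span ℂ S) := by
  refine ⟨fun a ha b hb => ?_, fun a ha b hb => ?_⟩
  · induction ha, hb using Submodule.span_induction₂ with
    | mem_mem x y hx hy => exact Submodule.subset_span (hmul x hx y hy)
    | zero_left y hy => simp
    | zero_right x hx => simp
    | add_left x y z _ _ _ h₁ h₂ => rw [add_mul]; exact add_mem h₁ h₂
    | add_right x y z _ _ _ h₁ h₂ => rw [mul_add]; exact add_mem h₁ h₂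
    | smul_left t x y _ _ h => rw [smul_mul_assoc]; exact Submodule.smul_mem _ _ h
    | smul_right t x y _ _ h => rw [mul_smul_comm]; exact Submodule.smul_mem _ _ h
  · induction ha, hb using Submodule.span_induction₂ with
    | mem_mem x y hx hy => exact htr x hx y hy
    | zero_left y hy => simp
    | zero_right x hx => simp
    | add_left x y z _ _ _ h₁ h₂ => simp [add_mul, h₁, h₂]
    | add_right x y z _ _ _ h₁ h₂ => simp [mul_add, h₁, h₂]
    | smul_left t x y _ _ h => simp [h, mul_assoc]
    | smul_right t x y _ _ h => simp [h, mul_left_comm]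

/-- Words in a family of letters span a trace-multiplicative algebra, provided the trace of
every nonempty word is the product of scalars attached to its letters. -/
lemma span_words {κ : Type*} (w : κ → Matrix h h ℂ) (c : κ → ℂ)
    (htr : ∀ l : List κ, l ≠ [] → (l.map w).prod.trace = (l.map c).prod) :
    IsTraceMul (Submodule.span ℂ {a | ∃ l : List κ, l ≠ [] ∧ a = (l.map w).prod}) := by
  refine span ?_ ?_
  · rintro _ ⟨l, hl, rfl⟩ _ ⟨l', -, rfl⟩
    exact ⟨l ++ l', by simp [hl], by simp⟩
  · rintro _ ⟨l, hl, rfl⟩ _ ⟨l', hl', rfl⟩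
    rw [htr l hl, htr l' hl', ← List.prod_append, ← List.map_append, htr (l ++ l') (by simp [hl]),
      List.map_append, List.prod_append]

end IsTraceMul

end TraceMultiplicative

section Decoupling

set_option linter.unusedSectionVars false

open scoped MatrixOrder in
/-- Sandwiching a positive definite matrix preserves the rank. -/
lemma rank_mul_posDef_mul_conjTranspose {m n : Type*} [Fintype m] [Fintype n] [DecidableEq n]
    (B : Matrix m n ℂ) {Q : Matrix n n ℂ} (hQ : Q.PosDef) : (B * Q * Bᴴ).rank = B.rank := by
  obtain ⟨y, hy⟩ := CStarAlgebra.nonneg_iff_eq_star_mul_self.mp hQ.posSemidef.nonneg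
  have hdet : IsUnit yᴴ.det := by
    have := (Matrix.isUnit_iff_isUnit_det _).1 hQ.isUnit
    rw [hy, Matrix.det_mul, star_eq_conjTranspose] at this
    exact isUnit_of_mul_isUnit_left this
  have h1 : B * Q * Bᴴ = (B * yᴴ) * (B * yᴴ)ᴴ := by
    rw [hy, star_eq_conjTranspose, conjTranspose_mul, conjTranspose_conjTranspose]
    simp only [Matrix.mul_assoc]
  rw [h1, Matrix.rank_self_mul_conjTranspose, Matrix.rank_mul_eq_left_of_isUnit_det _ _ hdet]

/-- The matrix whose rank is the left rank. -/
def leftMat {ι κ ν : Type*} (X : ι → κ → Matrix ν ν ℂ) : Matrix (ι × ν) (κ × ν) ℂ :=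
  Matrix.of fun r c => X r.1 c.1 r.2 c.2

/-- The transfer matrix between two columns of an MPO tensor. -/
def ladder {ι ν : Type*} [Fintype ι] (X : ι → ι → Matrix ν ν ℂ) (m m' : ι) :
    Matrix (ν × ν) (ν × ν) ℂ :=
  ∑ n, X n m ⊗ₖ mconj (X n m')

variable {ι ν : Type*} [Fintype ι] [DecidableEq ι] [Fintype ν] [DecidableEq ν]

lemma ladder_apply (X : ι → ι → Matrix ν ν ℂ) (m m' : ι) (a b : ν × ν) :
    ladder X m m' a b = ∑ n, X n m a.1 b.1 * star (X n m' a.2 b.2) := by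
  simp [ladder, Matrix.sum_apply, mconj]

lemma mconj_mul {l m n : Type*} [Fintype m] (A : Matrix l m ℂ) (B : Matrix m n ℂ) :
    mconj (A * B) = mconj A * mconj B := Matrix.map_mul

lemma ladder_mul_apply (X : ι → ι → Matrix ν ν ℂ) (a a' b b' : ι) (x y : ν × ν) :
    (ladder X a a' * ladder X b b') x y = ∑ n₁, ∑ n₂, (X n₁ a * X n₂ b) x.1 y.1 *
      star ((X n₁ a' * X n₂ b') x.2 y.2) := by
  simp only [ladder, Finset.sum_mul_sum, ← Matrix.mul_kronecker_mul, ← mconj_mul,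
    Matrix.sum_apply]
  rfl

/-- The vector with the entries of a square matrix. -/
def vecOf (τ : Matrix ν ν ℂ) : ν × ν → ℂ := fun x => τ x.1 x.2

lemma leftMat_gram (X : ι → ι → Matrix ν ν ℂ) (τ : Matrix ν ν ℂ) (m m' : ι) (γ γ' : ν) :
    ((leftMat X)ᵀ * ((1 : Matrix ι ι ℂ) ⊗ₖ τ) * (leftMat X)ᵀᴴ) (m, γ) (m', γ') =
      (vecOf τ ᵥ* ladder X m m') (γ, γ') := by
  simp only [Matrix.mul_apply, Matrix.vecMul, dotProduct, ladder_apply, vecOf,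
    Fintype.sum_prod_type, Matrix.kroneckerMap_apply, Matrix.one_apply, leftMat,
    Matrix.transpose_apply, Matrix.conjTranspose_apply, Matrix.of_apply, Finset.sum_mul,
    Finset.mul_sum, ite_mul, mul_ite, one_mul, zero_mul, mul_zero]
  rw [eq_comm, Finset.sum_comm_cycle]
  refine Finset.sum_congr rfl fun n _ => ?_
  rw [Finset.sum_comm]
  refine Finset.sum_congr rfl fun β' _ => ?_
  rw [Finset.sum_comm]
  refine Finset.sum_congr rfl fun β _ => ?_
  rw [Finset.sum_ite_eq' Finset.univ, if_pos (Finset.mem_univ _)]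
  ring

lemma leftMat_gram' (X : ι → ι → Matrix ν ν ℂ) (τ : Matrix ν ν ℂ) (m m' : ι) (γ γ' : ν) :
    ((leftMat fun n k => (X n k)ᵀ)ᵀ * ((1 : Matrix ι ι ℂ) ⊗ₖ τ) *
      (leftMat fun n k => (X n k)ᵀ)ᵀᴴ) (m, γ) (m', γ') =
      (ladder X m m' *ᵥ vecOf τ) (γ, γ') := by
  rw [leftMat_gram]
  simp only [Matrix.mulVec, Matrix.vecMul, dotProduct, ladder_apply, Matrix.transpose_apply]
  exact Finset.sum_congr rfl fun _ _ => mul_comm _ _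

/-- If the ladders decouple across a rank-one projector with positive definite factors, the
product of the two ranks of the tensor is maximal. -/
lemma rank_mul_rank_eq (X : ι → ι → Matrix ν ν ℂ) {ρ σ : Matrix ν ν ℂ} (hρ : ρ.PosDef)
    (hσ : σ.PosDef)
    (h1 : ∀ m₁ m₁' m₂ m₂', ladder X m₁ m₁' * ladder X m₂ m₂' =
      ladder X m₁ m₁' * vecMulVec (vecOf ρ) (vecOf σ) * ladder X m₂ m₂')
    (h2 : ∀ n₁ n₁' n₂ n₂', (ladder (fun a b => X b a) n₁ n₁' * ladder (fun a b => X b a) n₂ n₂' *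
      vecMulVec (vecOf ρ) (vecOf σ)).trace = if (n₁, n₂) = (n₁', n₂') then 1 else 0) :
    (leftMat fun n k => (X n k)ᵀ).rank * (leftMat X).rank = Fintype.card ι ^ 2 := by
  let T : Matrix ((ι × ν) × (ι × ν)) (ι × ι) ℂ :=
    Matrix.of fun r c => (X c.1 r.1.1 * X c.2 r.2.1) r.1.2 r.2.2
  have hT1 : T.rank = (leftMat fun n k => (X n k)ᵀ).rank * (leftMat X).rank := by
    have hgram : T * Tᴴ = ((leftMat fun n k => (X n k)ᵀ)ᵀ * ((1 : Matrix ι ι ℂ) ⊗ₖ ρ) *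
        (leftMat fun n k => (X n k)ᵀ)ᵀᴴ) ⊗ₖ
        ((leftMat X)ᵀ * ((1 : Matrix ι ι ℂ) ⊗ₖ σ) * (leftMat X)ᵀᴴ) := by
      ext ⟨⟨m₁, α⟩, ⟨m₂, γ⟩⟩ ⟨⟨m₁', α'⟩, ⟨m₂', γ'⟩⟩
      rw [Matrix.kroneckerMap_apply]
      change _ = (((leftMat fun n k => (X n k)ᵀ)ᵀ * ((1 : Matrix ι ι ℂ) ⊗ₖ ρ) *
        (leftMat fun n k => (X n k)ᵀ)ᵀᴴ) (m₁, α) (m₁', α')) *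
        (((leftMat X)ᵀ * ((1 : Matrix ι ι ℂ) ⊗ₖ σ) * (leftMat X)ᵀᴴ) (m₂, γ) (m₂', γ'))
      rw [leftMat_gram', leftMat_gram]
      have h3 := congrFun (congrFun (h1 m₁ m₁' m₂ m₂') (α, α')) (γ, γ')
      rw [Matrix.mul_vecMulVec, Matrix.vecMulVec_mul, vecMulVec_apply] at h3
      rw [← h3, ladder_mul_apply, Matrix.mul_apply, Fintype.sum_prod_type]
      rfl
    rw [← Matrix.rank_self_mul_conjTranspose, hgram, rank_kronecker,
      rank_mul_posDef_mul_conjTranspose _ (Matrix.PosDef.one.kronecker hρ),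
      rank_mul_posDef_mul_conjTranspose _ (Matrix.PosDef.one.kronecker hσ),
      Matrix.rank_transpose, Matrix.rank_transpose]
  let G : Matrix (ι × ι) ((ι × ν) × (ι × ν)) ℂ := Matrix.of fun c r =>
    ∑ α', ∑ γ', σ r.1.2 α' * ρ r.2.2 γ' * star ((X c.1 r.1.1 * X c.2 r.2.1) α' γ')
  have hGT : G * T = 1 := by
    ext ⟨n₁', n₂'⟩ ⟨n₁, n₂⟩
    rw [Matrix.one_apply]
    have h3 := h2 n₁ n₁' n₂ n₂'
    rw [if_congr (eq_comm (a := (n₁', n₂'))) rfl rfl, ← h3]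
    rw [Matrix.mul_vecMulVec, Matrix.trace_vecMulVec]
    simp only [Matrix.mulVec, dotProduct, ladder_mul_apply, Matrix.mul_apply (M := G), G, T, vecOf,
      Fintype.sum_prod_type, Matrix.of_apply, Finset.sum_mul]
    rw [Finset.sum_comm]
    refine Finset.sum_congr rfl fun α _ => ?_
    rw [Finset.sum_comm_cycle, eq_comm, Finset.sum_comm, eq_comm]
    refine Finset.sum_congr rfl fun γ _ => ?_
    rw [Finset.sum_comm_cycle]
    refine Finset.sum_congr rfl fun α' _ => ?_
    rw [Finset.sum_comm_cycle]
    exact Finset.sum_congr rfl fun γ' _ => Finset.sum_congr rfl fun m₁ _ =>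
      Finset.sum_congr rfl fun m₂ _ => by ring
  have hT2 : T.rank = Fintype.card ι ^ 2 := by
    rw [sq, ← Fintype.card_prod]
    refine le_antisymm (Matrix.rank_le_card_width _) ?_
    exact card_le_rank_of_mul_mul_eq_one (G := G) (H := 1) (by rw [Matrix.mul_one, hGT])
  rw [← hT1, hT2]

end Decoupling

section Words

set_option linter.unusedSectionVars false

variable {ι ν : Type*} [Fintype ι] [DecidableEq ι] [Fintype ν] [DecidableEq ν]

/-- The product of the matrices of an MPO tensor along a pair of configurations. -/
def word (V : ι → ι → Matrix ν ν ℂ) {N : ℕ} (n m : Fin N → ι) : Matrix ν ν ℂ :=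
  (List.ofFn fun j => V (n j) (m j)).prod

lemma word_cons (V : ι → ι → Matrix ν ν ℂ) {N : ℕ} (a b : ι) (n m : Fin N → ι) :
    word V (Fin.cons a n : Fin (N + 1) → ι) (Fin.cons b m : Fin (N + 1) → ι) =
      V a b * word V n m := by
  simp [word, List.ofFn_succ]

/-- The traces of words over configurations of any length form an isometry. -/
def TraceIsometric (V : ι → ι → Matrix ν ν ℂ) : Prop :=
  ∀ N : ℕ, 1 ≤ N → ∀ m m' : Fin N → ι,
    ∑ n, (word V n m).trace * star (word V n m').trace = if m = m' then 1 else 0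

lemma mconj_one : mconj (1 : Matrix ν ν ℂ) = 1 := Matrix.map_one _ (map_zero _) (map_one _)

lemma prod_ofFn_ladder (V : ι → ι → Matrix ν ν ℂ) {N : ℕ} (m m' : Fin N → ι) :
    (List.ofFn fun j => ladder V (m j) (m' j)).prod = ladder (word V (N := N)) m m' := by
  induction N with
  | zero => simp [ladder, word, mconj_one]
  | succ N ih =>
    obtain ⟨a, m, rfl⟩ : ∃ a x, m = Fin.cons a x := ⟨m 0, Fin.tail m, (Fin.cons_self_tail m).symm⟩
    obtain ⟨b, m', rfl⟩ : ∃ a x, m' = Fin.cons a x :=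
      ⟨m' 0, Fin.tail m', (Fin.cons_self_tail m').symm⟩
    rw [List.ofFn_succ, List.prod_cons]
    simp only [Fin.cons_zero, Fin.cons_succ]
    rw [ih, ladder, ladder, Finset.sum_mul_sum, ladder,
      ← (Fin.consEquiv (fun _ : Fin (N + 1) => ι)).sum_comp, Fintype.sum_prod_type]
    refine Finset.sum_congr rfl fun x _ => Finset.sum_congr rfl fun n _ => ?_
    rw [← Matrix.mul_kronecker_mul, ← mconj_mul, ← word_cons, ← word_cons]
    rfl

lemma trace_ladder {κ : Type*} [Fintype κ] (X : κ → κ → Matrix ν ν ℂ) (m m' : κ) :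
    (ladder X m m').trace = ∑ n, (X n m).trace * star (X n m').trace := by
  rw [ladder, Matrix.trace_sum]
  refine Finset.sum_congr rfl fun n _ => ?_
  rw [Matrix.trace_kronecker]
  congr 1
  simp [Matrix.trace, mconj]

/-- The span of all products of ladders. -/
def ladderAlg (V : ι → ι → Matrix ν ν ℂ) : Submodule ℂ (Matrix (ν × ν) (ν × ν) ℂ) :=
  Submodule.span ℂ {a | ∃ l : List (ι × ι), l ≠ [] ∧ a = (l.map fun x => ladder V x.1 x.2).prod}

lemma ladder_mem (V : ι → ι → Matrix ν ν ℂ) (m m' : ι) : ladder V m m' ∈ ladderAlg V :=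
  Submodule.subset_span ⟨[(m, m')], by simp, by simp⟩

lemma ladder_word_mem (V : ι → ι → Matrix ν ν ℂ) {N : ℕ} (hN : 1 ≤ N) (m m' : Fin N → ι) :
    ladder (word V (N := N)) m m' ∈ ladderAlg V := by
  refine Submodule.subset_span ⟨List.ofFn fun j => (m j, m' j), ?_, ?_⟩
  · rw [Ne, List.ofFn_eq_nil_iff]; omega
  · rw [List.map_ofFn, ← prod_ofFn_ladder]; rfl

lemma TraceIsometric.trace_ladder {V : ι → ι → Matrix ν ν ℂ} (hV : TraceIsometric V) {N : ℕ}
    (hN : 1 ≤ N) (m m' : Fin N → ι) :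
    (ladder (word V (N := N)) m m').trace = if m = m' then 1 else 0 := by
  rw [FQCA.trace_ladder, hV N hN]

lemma TraceIsometric.isTraceMul {V : ι → ι → Matrix ν ν ℂ} (hV : TraceIsometric V) :
    IsTraceMul (ladderAlg V) := by
  refine IsTraceMul.span_words _ (fun x => if x.1 = x.2 then 1 else 0) fun l hl => ?_
  obtain ⟨N, f, rfl⟩ : ∃ (N : ℕ) (f : Fin N → ι × ι), l = List.ofFn f :=
    ⟨_, l.get, (List.ofFn_get l).symm⟩
  have hN : 1 ≤ N := by
    rw [Ne, List.ofFn_eq_nil_iff] at hl; omega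
  rw [List.map_ofFn, List.map_ofFn, List.prod_ofFn (f := (fun x : ι × ι => _) ∘ f)]
  have h1 := hV.trace_ladder hN (fun j => (f j).1) (fun j => (f j).2)
  rw [← prod_ofFn_ladder] at h1
  refine h1.trans ?_
  simp only [Function.comp_apply, Finset.prod_ite_zero, Finset.prod_const_one, funext_iff,
    Finset.mem_univ, true_imp_iff]

/-- The normalised transfer matrix of an MPO tensor. -/
def meanLadder (V : ι → ι → Matrix ν ν ℂ) : Matrix (ν × ν) (ν × ν) ℂ :=
  (Fintype.card ι : ℂ)⁻¹ • ∑ m, ladder V m m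

lemma meanLadder_swap (V : ι → ι → Matrix ν ν ℂ) :
    meanLadder (fun a b => V b a) = meanLadder V := by
  simp only [meanLadder, ladder]
  rw [Finset.sum_comm]

lemma meanLadder_mem (V : ι → ι → Matrix ν ν ℂ) : meanLadder V ∈ ladderAlg V :=
  Submodule.smul_mem _ _ (Submodule.sum_mem _ fun m _ => ladder_mem V m m)

lemma TraceIsometric.trace_meanLadder [Nonempty ι] {V : ι → ι → Matrix ν ν ℂ}
    (hV : TraceIsometric V) : (meanLadder V).trace = 1 := by
  have h1 : ∀ m, (ladder V m m).trace = 1 := fun m => by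
    have := hV.trace_ladder le_rfl (fun _ => m) (fun _ => m)
    rwa [← prod_ofFn_ladder, if_pos rfl, List.ofFn_succ, List.ofFn_zero, List.prod_singleton]
      at this
  rw [meanLadder, Matrix.trace_smul, Matrix.trace_sum]
  simp [h1]

/-- Long words of a tensor whose transfer matrix has positive definite fixed points have
maximal product of ranks. -/
lemma rank_mul_rank_word {V : ι → ι → Matrix ν ν ℂ} (hV : TraceIsometric V)
    (hV' : TraceIsometric fun a b => V b a) {ρ σ : Matrix ν ν ℂ} (hρ : ρ.PosDef)
    (hσ : σ.PosDef) {N : ℕ} (hE : meanLadder V ^ (N + 1) = vecMulVec (vecOf ρ) (vecOf σ))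
    (ht : vecOf σ ⬝ᵥ vecOf ρ = 1) {q : ℕ} (hq1 : 1 ≤ q) (hq : Fintype.card (ν × ν) ≤ q) :
    (leftMat fun n k => (word V (N := q) n k)ᵀ).rank * (leftMat (word V (N := q))).rank =
      Fintype.card ι ^ (2 * q) := by
  have hP : vecMulVec (vecOf ρ) (vecOf σ) ∈ ladderAlg V :=
    hE ▸ (hV.isTraceMul.pow_mem (meanLadder_mem V) N).1
  have hP' : vecMulVec (vecOf ρ) (vecOf σ) ∈ ladderAlg fun a b => V b a := by
    rw [← hE, ← meanLadder_swap]
    exact (hV'.isTraceMul.pow_mem (meanLadder_mem _) N).1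
  rw [rank_mul_rank_eq (word V (N := q)) hρ hσ, Fintype.card_fun, Fintype.card_fin, ← pow_mul, mul_comm q]
  · intro m₁ m₁' m₂ m₂'
    rw [← sub_eq_zero, ← prod_ofFn_ladder, ← prod_ofFn_ladder]
    have := hV.isTraceMul.prod_mul_one_sub_mul_prod hP ht
      (l₁ := List.ofFn fun j => ladder V (m₁ j) (m₁' j))
      (l₂ := List.ofFn fun j => ladder V (m₂ j) (m₂' j)) ?_ ?_ (by simpa using hq)
      (by simpa using hq)
    · rw [← this]; noncomm_ring
    · rintro a ha
      obtain ⟨j, rfl⟩ := (List.mem_ofFn' _ _).1 ha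
      exact ladder_mem V _ _
    · rintro a ha
      obtain ⟨j, rfl⟩ := (List.mem_ofFn' _ _).1 ha
      exact ladder_mem V _ _
  · intro n₁ n₁' n₂ n₂'
    have h1 := ladder_word_mem (fun a b => V b a) hq1 n₁ n₁'
    have h2 := ladder_word_mem (fun a b => V b a) hq1 n₂ n₂'
    have hA := hV'.isTraceMul
    change (ladder (word fun a b => V b a) n₁ n₁' * ladder (word fun a b => V b a) n₂ n₂' *
      vecMulVec (vecOf ρ) (vecOf σ)).trace = _
    rw [hA.trace_mul _ (hA.mul_mem _ h1 _ h2) _ hP', hA.trace_mul _ h1 _ h2,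
      hV'.trace_ladder hq1, hV'.trace_ladder hq1, Matrix.trace_vecMulVec, dotProduct_comm, ht]
    simp only [Prod.mk.injEq, ite_and]
    split_ifs <;> simp

end Words

section FixedPoints

set_option linter.unusedSectionVars false

lemma sgn_add (a b : ZMod 2) : sgn (a + b) = sgn a * sgn b := by
  rw [sgn, sgn, sgn, ← pow_add, ZMod.val_add, ← neg_one_pow_eq_pow_mod_two]

variable {ν : Type*} [Fintype ν] [DecidableEq ν]

lemma IsParityMatrix.exists_eq_diagonal {Z : Matrix ν ν ℂ} (hZ : IsParityMatrix Z) :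
    ∃ z : ν → ℂ, Z = diagonal z ∧ ∀ α, z α = 1 ∨ z α = -1 :=
  ⟨diag Z, hZ.1.diagonal_diag.symm, hZ.2⟩

lemma IsParityMatrix.mul_self {Z : Matrix ν ν ℂ} (hZ : IsParityMatrix Z) : Z * Z = 1 := by
  obtain ⟨z, rfl, hz⟩ := hZ.exists_eq_diagonal
  rw [diagonal_mul_diagonal, ← diagonal_one]
  congr 1
  ext α
  rcases hz α with h | h <;> simp [h]

lemma IsParityMatrix.conjTranspose_eq {Z : Matrix ν ν ℂ} (hZ : IsParityMatrix Z) : Zᴴ = Z := by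
  obtain ⟨z, rfl, hz⟩ := hZ.exists_eq_diagonal
  rw [diagonal_conjTranspose]
  congr 1
  ext α
  rcases hz α with h | h <;> simp [h]

/-- The orthogonal projector on the kernel of a Hermitian matrix. -/
lemma exists_kernel_projection {τ : Matrix ν ν ℂ} (hτ : τ.IsHermitian) :
    ∃ P g : Matrix ν ν ℂ, P * P = P ∧ Pᴴ = P ∧ τ * P = 0 ∧ g * τ = 1 - P := by
  set φ := Unitary.conjStarAlgAut ℂ (Matrix ν ν ℂ) hτ.eigenvectorUnitary
  have hspec : τ = φ (diagonal (RCLike.ofReal ∘ hτ.eigenvalues)) := hτ.spectral_theorem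
  refine ⟨φ (diagonal fun i => if hτ.eigenvalues i = 0 then 1 else 0),
    φ (diagonal fun i => (hτ.eigenvalues i : ℂ)⁻¹), ?_, ?_, ?_, ?_⟩
  · rw [← map_mul, diagonal_mul_diagonal]
    simp
  · rw [← star_eq_conjTranspose, ← map_star, star_eq_conjTranspose, diagonal_conjTranspose]
    congr 2
    ext i
    simp only [Pi.star_apply]
    split_ifs <;> simp
  · refine (congrArg (· * φ _) hspec).trans ?_
    rw [← map_mul, diagonal_mul_diagonal, ← map_zero φ]
    congr 1
    rw [← diagonal_zero]
    congr 1
    ext i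
    simp
  · refine (congrArg (φ _ * ·) hspec).trans ?_
    rw [← map_mul, diagonal_mul_diagonal, ← map_one φ, ← map_sub, ← diagonal_one, diagonal_sub]
    congr 2
    ext i
    by_cases h : hτ.eigenvalues i = 0 <;> simp [h]

open scoped MatrixOrder in
/-- The kernel projector of a graded positive fixed point is graded and invariant. -/
lemma kernel_projection_of_fixed {κ : Type*} [Fintype κ] (B : κ → Matrix ν ν ℂ)
    {Z τ : Matrix ν ν ℂ} (hZ : Zᴴ = Z) (hτ : τ.PosSemidef) (hτZ : τ * Z = Z * τ)
    (hfix : ∑ i, (B i)ᴴ * τ * B i = τ) :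
    ∃ P : Matrix ν ν ℂ, P * P = P ∧ Pᴴ = P ∧ P * Z = Z * P ∧ (∀ i, B i * P = P * (B i * P)) ∧
      (P = 0 → τ.PosDef) ∧ (P = 1 → τ = 0) := by
  obtain ⟨P, g, hPP, hPh, hτP, hg⟩ := exists_kernel_projection hτ.isHermitian
  have hker : ∀ M : Matrix ν ν ℂ, τ * M = 0 → M = P * M := by
    intro M hM
    have : (1 - P) * M = 0 := by rw [← hg, mul_assoc, hM, mul_zero]
    rwa [sub_mul, one_mul, sub_eq_zero] at this
  refine ⟨P, hPP, hPh, ?_, ?_, ?_, ?_⟩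
  · have h1 : Z * P = P * (Z * P) := hker _ (by rw [← mul_assoc, hτZ, mul_assoc, hτP, mul_zero])
    have h2 := congrArg conjTranspose h1
    rw [conjTranspose_mul, conjTranspose_mul, conjTranspose_mul, hPh, hZ] at h2
    rw [h2, h1, mul_assoc]
  · obtain ⟨y, hy⟩ := CStarAlgebra.nonneg_iff_eq_star_mul_self.mp hτ.nonneg
    rw [star_eq_conjTranspose] at hy
    intro i
    refine hker _ ?_
    have hsum : ∑ i, ((y * B i * P)ᴴ * (y * B i * P)).trace = 0 := by
      rw [← Matrix.trace_sum]
      have : ∑ i, (y * B i * P)ᴴ * (y * B i * P) = Pᴴ * (∑ i, (B i)ᴴ * τ * B i) * P := by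
        rw [Finset.mul_sum, Finset.sum_mul]
        refine Finset.sum_congr rfl fun i _ => ?_
        rw [hy]
        simp only [conjTranspose_mul, mul_assoc]
      rw [this, hfix, mul_assoc, hτP, mul_zero, Matrix.trace_zero]
    have hnn : ∀ i ∈ Finset.univ, 0 ≤ ((y * B i * P)ᴴ * (y * B i * P)).trace := fun i _ =>
      (posSemidef_conjTranspose_mul_self _).trace_nonneg
    have h0 := (Finset.sum_eq_zero_iff_of_nonneg hnn).1 hsum i (Finset.mem_univ i)
    rw [trace_conjTranspose_mul_self_eq_zero_iff] at h0
    rw [hy, mul_assoc, ← mul_assoc y, h0, mul_zero]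
  · rintro rfl
    refine hτ.posDef_iff_isUnit.2 ?_
    rw [sub_zero] at hg
    exact IsUnit.of_mul_eq_one_right _ hg
  · rintro rfl
    rwa [mul_one] at hτP

/-- Graded positive fixed points of a graded irreducible tensor are positive definite. -/
lemma posDef_of_left_fixed {κ : Type*} [Fintype κ] {A : κ → Matrix ν ν ℂ} {Z τ : Matrix ν ν ℂ}
    (hA : GradedIrreducible A Z) (hZ : Zᴴ = Z) (hτ : τ.PosSemidef) (hτ0 : τ ≠ 0)
    (hτZ : τ * Z = Z * τ) (hfix : ∑ i, (A i)ᴴ * τ * A i = τ) : τ.PosDef := by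
  obtain ⟨P, h1, h2, h3, h4, h5, h6⟩ := kernel_projection_of_fixed A hZ hτ hτZ hfix
  by_contra hcon
  exact hA ⟨P, h1, h2, fun h => hcon (h5 h), fun h => hτ0 (h6 h), h3, h4⟩

lemma posDef_of_right_fixed {κ : Type*} [Fintype κ] {A : κ → Matrix ν ν ℂ} {Z τ : Matrix ν ν ℂ}
    (hA : GradedIrreducible A Z) (hZ : Zᴴ = Z) (hτ : τ.PosSemidef) (hτ0 : τ ≠ 0)
    (hτZ : τ * Z = Z * τ) (hfix : ∑ i, A i * τ * (A i)ᴴ = τ) : τ.PosDef := by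
  obtain ⟨P, h1, h2, h3, h4, h5, h6⟩ := kernel_projection_of_fixed (fun i => (A i)ᴴ) hZ hτ hτZ
    (by simpa using hfix)
  by_contra hcon
  refine hA ⟨1 - P, ?_, ?_, fun h => hτ0 (h6 (sub_eq_zero.1 h).symm), fun h => hcon (h5 ?_), ?_,
    fun i => ?_⟩
  · rw [mul_sub, mul_one, sub_mul, one_mul, h1, sub_self, sub_zero]
  · rw [conjTranspose_sub, conjTranspose_one, h2]
  · simpa using h
  · rw [sub_mul, mul_sub, h3, one_mul, mul_one]
  · have := congrArg conjTranspose (h4 i)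
    rw [conjTranspose_mul, conjTranspose_mul, conjTranspose_mul, conjTranspose_conjTranspose, h2]
      at this
    have h7 : P * (A i * (1 - P)) = 0 := by
      rw [← mul_assoc, mul_sub, mul_one, ← this, sub_self]
    rw [sub_mul (1 : Matrix ν ν ℂ), one_mul, h7, sub_zero]

/-- Powers of a transfer matrix are transfer matrices of tensors that are homogeneous again. -/
lemma exists_transfer_pow.{u} {κ : Type u} [Fintype κ] {p : κ → ZMod 2} {A : κ → Matrix ν ν ℂ}
    {Z : Matrix ν ν ℂ} (hA : EvenTensor p A Z) (k : ℕ) :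
    ∃ (τ : Type u) (_ : Fintype τ) (x : τ → ZMod 2) (X : τ → Matrix ν ν ℂ),
      EvenTensor x X Z ∧ transfer A ^ k = transfer X := by
  induction k with
  | zero =>
    refine ⟨PUnit, inferInstance, fun _ => 0, fun _ => 1, fun _ => by simp [sgn], ?_⟩
    simp [transfer, mconj_one]
  | succ k ih =>
    obtain ⟨τ, _, x, X, hX, hk⟩ := ih
    refine ⟨τ × κ, inferInstance, fun y => x y.1 + p y.2, fun y => X y.1 * A y.2, fun y => ?_, ?_⟩
    · rw [← mul_assoc, hX, smul_mul_assoc, mul_assoc, hA, mul_smul_comm, smul_smul, sgn_add, mul_assoc]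
    · rw [pow_succ, hk, transfer, transfer, Finset.sum_mul_sum, transfer, Fintype.sum_prod_type]
      simp only [← Matrix.mul_kronecker_mul, ← mconj_mul]

lemma transfer_mulVec {κ : Type*} [Fintype κ] (A : κ → Matrix ν ν ℂ) (M : Matrix ν ν ℂ) :
    transfer A *ᵥ vecOf M = vecOf (∑ i, A i * M * (A i)ᴴ) := by
  ext ⟨a, b⟩
  simp only [transfer, Matrix.sum_mulVec, Finset.sum_apply, vecOf, Matrix.sum_apply]
  refine Finset.sum_congr rfl fun i _ => ?_
  simp only [Matrix.mulVec, dotProduct, Fintype.sum_prod_type, Matrix.kroneckerMap_apply, mconj,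
    Matrix.map_apply, Matrix.mul_apply, Matrix.conjTranspose_apply, Finset.sum_mul]
  rw [Finset.sum_comm]
  exact Finset.sum_congr rfl fun _ _ => Finset.sum_congr rfl fun _ _ => by
    simp only [starRingEnd_apply, vecOf]; ring

lemma vecMul_transfer {κ : Type*} [Fintype κ] (A : κ → Matrix ν ν ℂ) (M : Matrix ν ν ℂ) :
    vecOf M ᵥ* transfer A = vecOf (∑ i, (A i)ᴴ * Mᵀ * A i)ᵀ := by
  ext ⟨a, b⟩
  simp only [transfer, Matrix.vecMul_sum, Finset.sum_apply, vecOf, Matrix.sum_apply,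
    Matrix.transpose_apply]
  refine Finset.sum_congr rfl fun i _ => ?_
  simp only [Matrix.vecMul, dotProduct, Fintype.sum_prod_type, Matrix.kroneckerMap_apply, mconj,
    Matrix.map_apply, Matrix.mul_apply, Matrix.conjTranspose_apply, Finset.sum_mul,
    Matrix.transpose_apply]
  exact Finset.sum_congr rfl fun _ _ => Finset.sum_congr rfl fun _ _ => by
    simp only [starRingEnd_apply, vecOf]; ring

end FixedPoints

section PositiveFixedPoints

set_option linter.unusedSectionVars false

variable {ν κ : Type*} [Fintype ν] [DecidableEq ν] [Fintype κ]

lemma vecOf_one_dotProduct (M : Matrix ν ν ℂ) : vecOf 1 ⬝ᵥ vecOf M = M.trace := by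
  simp [vecOf, dotProduct, Fintype.sum_prod_type, Matrix.one_apply, Matrix.trace]

lemma vecOf_injective : Function.Injective (vecOf (ν := ν)) := fun M M' h => by
  ext a b
  exact congrFun h (a, b)

/-- If a power of the transfer matrix of an even tensor is a rank-one projector, then its two
factors are positive semidefinite and graded. -/
lemma exists_posSemidef_factors {p : κ → ZMod 2} {A : κ → Matrix ν ν ℂ} {Z : Matrix ν ν ℂ}
    (hZ : IsParityMatrix Z) (hA : EvenTensor p A Z) {N : ℕ} {r s : ν × ν → ℂ}
    (hE : transfer A ^ (N + 1) = vecMulVec r s) (hrs : s ⬝ᵥ r = 1) :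
    ∃ ρ τ : Matrix ν ν ℂ, vecMulVec r s = vecMulVec (vecOf ρ) (vecOf τᵀ) ∧ ρ.PosSemidef ∧
      τ.PosSemidef ∧ ρ * Z = Z * ρ ∧ τ * Z = Z * τ := by
  obtain ⟨T, _, x, X, hX, hk⟩ := exists_transfer_pow hA (N + 1)
  rw [hE] at hk
  set ρ := ∑ i, X i * (X i)ᴴ with hρ
  set τ := ∑ i, (X i)ᴴ * X i with hτ
  have h1 : vecOf ρ = (s ⬝ᵥ vecOf 1) • r := by
    have := transfer_mulVec X 1
    simp only [mul_one] at this
    rw [hρ, ← this, ← hk]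
    ext i
    simp [Matrix.mulVec, vecMulVec_apply, dotProduct, Finset.sum_mul]
    exact Finset.sum_congr rfl fun _ _ => by ring
  have h2 : vecOf τᵀ = (vecOf 1 ⬝ᵥ r) • s := by
    have := vecMul_transfer X 1
    simp only [Matrix.transpose_one, mul_one] at this
    rw [hτ, ← this, ← hk]
    ext i
    simp [Matrix.vecMul, vecMulVec_apply, dotProduct, Finset.sum_mul]
    exact Finset.sum_congr rfl fun _ _ => by ring
  have hρp : ρ.PosSemidef := posSemidef_sum _ fun i _ => posSemidef_self_mul_conjTranspose _
  have hτp : τ.PosSemidef := posSemidef_sum _ fun i _ => posSemidef_conjTranspose_mul_self _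
  have ht : ρ.trace = (s ⬝ᵥ vecOf 1) * (vecOf 1 ⬝ᵥ r) := by
    rw [← vecOf_one_dotProduct, h1, dotProduct_smul, smul_eq_mul]
  have ht0 : ρ.trace ≠ 0 := by
    intro h0
    rw [hρ, Matrix.trace_sum, Finset.sum_eq_zero_iff_of_nonneg fun i _ =>
      (posSemidef_self_mul_conjTranspose _).trace_nonneg] at h0
    have hX0 : ∀ i, X i = 0 := fun i =>
      trace_mul_conjTranspose_self_eq_zero_iff.1 (h0 i (Finset.mem_univ i))
    have : (vecMulVec r s).trace = 0 := by
      rw [hk, transfer]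
      simp [hX0]
    rw [Matrix.trace_vecMulVec, dotProduct_comm, hrs] at this
    exact one_ne_zero this
  have htpos : 0 ≤ (ρ.trace)⁻¹ := inv_nonneg.2 hρp.trace_nonneg
  have hcomm : ∀ i, X i * (X i)ᴴ * Z = Z * (X i * (X i)ᴴ) ∧
      (X i)ᴴ * X i * Z = Z * ((X i)ᴴ * X i) := by
    intro i
    have he := hX i
    have he' : (X i)ᴴ * Z = sgn (x i) • (Z * (X i)ᴴ) := by
      have := congrArg conjTranspose he
      rw [conjTranspose_mul, conjTranspose_smul, conjTranspose_mul, hZ.conjTranspose_eq] at this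
      rw [this]
      congr 1
      simp [sgn]
    have hss : sgn (x i) * sgn (x i) = 1 := by
      rw [← sgn_add, CharTwo.add_self_eq_zero]; simp [sgn]
    have he2 : X i * Z = sgn (x i) • (Z * X i) := by rw [he, smul_smul, hss, one_smul]
    constructor
    · rw [mul_assoc, he', mul_smul_comm, ← mul_assoc, ← smul_mul_assoc, ← he, mul_assoc]
    · rw [mul_assoc, he2, mul_smul_comm, ← mul_assoc, ← smul_mul_assoc, he', smul_smul, hss,
        one_smul, mul_assoc]
  refine ⟨ρ, (ρ.trace)⁻¹ • τ, ?_, hρp, hτp.smul htpos, ?_, ?_⟩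
  · have h3 : vecOf ((ρ.trace)⁻¹ • τ)ᵀ = (ρ.trace)⁻¹ • vecOf τᵀ := rfl
    rw [h3, h1, h2]
    ext i j
    simp only [vecMulVec_apply, Pi.smul_apply, smul_eq_mul]
    have : r i * s j = (ρ.trace)⁻¹ * ((s ⬝ᵥ vecOf 1) * (vecOf 1 ⬝ᵥ r)) * (r i * s j) := by
      rw [← ht, inv_mul_cancel₀ ht0, one_mul]
    rw [this]
    ring
  · rw [hρ, Finset.sum_mul, Finset.mul_sum]
    exact Finset.sum_congr rfl fun i _ => (hcomm i).1
  · rw [smul_mul_assoc, mul_smul_comm, hτ, Finset.sum_mul, Finset.mul_sum]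
    congr 1
    exact Finset.sum_congr rfl fun i _ => (hcomm i).2

/-- If a power of the transfer matrix of a graded irreducible even tensor is a rank-one
projector, then its two factors are positive definite. -/
lemma exists_posDef_factors {p : κ → ZMod 2} {A : κ → Matrix ν ν ℂ} {Z : Matrix ν ν ℂ}
    (hZ : IsParityMatrix Z) (hA : EvenTensor p A Z) (hirr : GradedIrreducible A Z) {N : ℕ}
    {r s : ν × ν → ℂ} (hE : transfer A ^ (N + 1) = vecMulVec r s) (hrs : s ⬝ᵥ r = 1)
    (hEP : transfer A * vecMulVec r s = vecMulVec r s) :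
    ∃ ρ σ : Matrix ν ν ℂ, vecMulVec r s = vecMulVec (vecOf ρ) (vecOf σ) ∧ ρ.PosDef ∧
      σ.PosDef := by
  obtain ⟨ρ, τ, hP, hρ, hτ, hρZ, hτZ⟩ := exists_posSemidef_factors hZ hA hE hrs
  have hPE : vecMulVec r s * transfer A = vecMulVec r s := by
    rw [← hE, ← pow_succ, pow_succ', hE, hEP]
  have hdot : vecOf τᵀ ⬝ᵥ vecOf ρ = 1 := by
    rw [dotProduct_comm, ← Matrix.trace_vecMulVec, ← hP, Matrix.trace_vecMulVec, dotProduct_comm,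
      hrs]
  have hPρ : vecMulVec r s *ᵥ vecOf ρ = vecOf ρ := by
    rw [hP]
    ext i
    simp only [Matrix.mulVec, vecMulVec_apply, dotProduct, mul_assoc, ← Finset.mul_sum] at hdot ⊢
    rw [hdot, mul_one]
  have hτP : vecOf τᵀ ᵥ* vecMulVec r s = vecOf τᵀ := by
    rw [hP]
    ext i
    simp only [Matrix.vecMul, vecMulVec_apply, dotProduct, ← mul_assoc, ← Finset.sum_mul]
      at hdot ⊢
    rw [hdot, one_mul]
  have hρfix : ∑ i, A i * ρ * (A i)ᴴ = ρ := by
    apply vecOf_injective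
    rw [← transfer_mulVec]
    nth_rewrite 1 [← hPρ]
    rw [Matrix.mulVec_mulVec, hEP, hPρ]
  have hτfix : ∑ i, (A i)ᴴ * τ * A i = τ := by
    apply Matrix.transpose_injective
    apply vecOf_injective
    have := vecMul_transfer A τᵀ
    rw [Matrix.transpose_transpose] at this
    rw [← this]
    nth_rewrite 1 [← hτP]
    rw [Matrix.vecMul_vecMul, hPE, hτP]
  have h0 : vecOf (0 : Matrix ν ν ℂ) = 0 := rfl
  have hρ0 : ρ ≠ 0 := by
    rintro rfl
    rw [h0, dotProduct_zero] at hdot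
    exact zero_ne_one hdot
  have hτ0 : τ ≠ 0 := by
    rintro rfl
    rw [Matrix.transpose_zero, h0, zero_dotProduct] at hdot
    exact zero_ne_one hdot
  exact ⟨ρ, τᵀ, hP, posDef_of_right_fixed hirr hZ.conjTranspose_eq hρ hρ0 hρZ hρfix,
    (posDef_of_left_fixed hirr hZ.conjTranspose_eq hτ hτ0 hτZ hτfix).transpose⟩

end PositiveFixedPoints

section Gauge

set_option linter.unusedSectionVars false

section Parity

variable {κ h : Type*} [Fintype h] [DecidableEq h] {Z : Matrix h h ℂ} {A : κ → Matrix h h ℂ}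
  {p : κ → ZMod 2}

lemma zmod_two_cases (x : ZMod 2) : x = 0 ∨ x = 1 := by revert x; decide

lemma pow_val_add (hZ : Z * Z = 1) (x y : ZMod 2) :
    Z ^ (x + y).val = Z ^ x.val * Z ^ y.val := by
  rcases zmod_two_cases x with rfl | rfl <;> rcases zmod_two_cases y with rfl | rfl <;>
    simp [ZMod.val_one, hZ, CharTwo.add_self_eq_zero]

lemma pow_val_mul_self (hZ : Z * Z = 1) (x : ZMod 2) : Z ^ x.val * Z ^ x.val = 1 := by
  rw [← pow_val_add hZ, CharTwo.add_self_eq_zero]; simp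

lemma sgn_zero : sgn 0 = 1 := by simp [sgn]

lemma sgn_mul_self (x : ZMod 2) : sgn x * sgn x = 1 := by
  rw [← sgn_add, CharTwo.add_self_eq_zero, sgn_zero]

lemma EvenTensor.pow_mul (hA : EvenTensor p A Z) (x : ZMod 2) (i : κ) :
    Z ^ x.val * A i = sgn (x * p i) • (A i * Z ^ x.val) := by
  rcases zmod_two_cases x with rfl | rfl
  · simp [sgn]
  · simpa [ZMod.val_one] using hA i

lemma EvenTensor.list_prod (hA : EvenTensor p A Z) (l : List κ) :
    Z * (l.map A).prod = sgn (l.map p).sum • ((l.map A).prod * Z) := by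
  induction l with
  | nil => simp [sgn]
  | cons i l ih =>
    rw [List.map_cons, List.prod_cons, ← mul_assoc, hA i, Matrix.smul_mul, mul_assoc, ih,
      Matrix.mul_smul, smul_smul, List.map_cons, List.sum_cons, sgn_add, mul_assoc]

end Parity

variable {ι ν : Type*} [Fintype ι] [DecidableEq ι] [Fintype ν] [DecidableEq ν]

/-- The bosonic MPO tensor obtained by absorbing the fermionic signs into the bond. -/
def gauge (p : ι → ZMod 2) (Z : Matrix ν ν ℂ) (U : ι → ι → Matrix ν ν ℂ) :
    ι → ι → Matrix ν ν ℂ :=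
  fun n m => U n m * Z ^ (p m).val

variable {p : ι → ZMod 2} {Z : Matrix ν ν ℂ} {U : ι → ι → Matrix ν ν ℂ}

lemma evenTensor_gauge (hU : EvenTensor (doubledP p) (doubledT U) Z) :
    EvenTensor (doubledP p) (doubledT (gauge p Z U)) Z := fun x => by
  have := hU x
  simp only [doubledT, gauge] at *
  rw [← mul_assoc, this, Matrix.smul_mul, mul_assoc, mul_assoc, ← pow_succ, ← pow_succ']

lemma evenTensor_word (hU : EvenTensor (doubledP p) (doubledT U) Z) (N : ℕ) :
    EvenTensor (doubledP fun n : Fin N → ι => ∑ j, p (n j)) (doubledT (word U (N := N))) Z := by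
  rintro ⟨n, m⟩
  have := hU.list_prod (List.ofFn fun j => (n j, m j))
  simp only [List.map_ofFn, List.sum_ofFn] at this
  simpa only [doubledT, doubledP, word, Function.comp_def, Finset.sum_add_distrib] using this

lemma blockSign_cons {N : ℕ} (a b : ι) (n m : Fin N → ι) :
    blockSign p (Fin.cons a n : Fin (N + 1) → ι) (Fin.cons b m : Fin (N + 1) → ι) =
      p b * ∑ l, (p (n l) + p (m l)) + blockSign p n m := by
  simp [blockSign, Finset.sum_filter, Fintype.sum_prod_type, Fin.sum_univ_succ, Finset.mul_sum]

lemma mpoSign_eq_blockSign {N : ℕ} (n m : Fin N → ι) : mpoSign p n m = blockSign p n m := by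
  rw [mpoSign, blockSign, Finset.sum_filter, Finset.sum_filter, ← (Equiv.prodComm _ _).sum_comp]
  simp [mul_comm]

lemma blocked_eq (hZ : Z * Z = 1) (hU : EvenTensor (doubledP p) (doubledT U) Z) {N : ℕ}
    (n m : Fin N → ι) :
    blocked p U N n m = word (gauge p Z U) n m * Z ^ (∑ j, p (m j)).val := by
  induction N with
  | zero => simp [blocked, word, blockSign, sgn]
  | succ N ih =>
    obtain ⟨a, n, rfl⟩ : ∃ a x, n = Fin.cons a x := ⟨n 0, Fin.tail n, (Fin.cons_self_tail n).symm⟩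
    obtain ⟨b, m, rfl⟩ : ∃ a x, m = Fin.cons a x := ⟨m 0, Fin.tail m, (Fin.cons_self_tail m).symm⟩
    have h1 := (evenTensor_word (evenTensor_gauge hU) N).pow_mul (p b) (n, m)
    simp only [doubledT, doubledP] at h1
    have h2 : blocked p U (N + 1) (Fin.cons a n) (Fin.cons b m) =
        sgn (p b * ∑ l, (p (n l) + p (m l))) • (U a b * blocked p U N n m) := by
      rw [blocked, blocked, blockSign_cons, sgn_add, Matrix.mul_smul, smul_smul]
      simp [List.ofFn_succ]
    rw [h2, ih, word_cons, Fin.sum_univ_succ]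
    simp only [Fin.cons_zero, Fin.cons_succ]
    rw [pow_val_add hZ, Finset.sum_add_distrib, gauge, mul_assoc (U a b), h1,
      Matrix.mul_smul, Matrix.smul_mul, mul_assoc, mul_assoc]
    congr 3
    rw [← mul_assoc (Z ^ (p b).val), pow_val_mul_self hZ, one_mul]

lemma fMPO_apply {N : ℕ} (n m : Fin N → ι) : fMPO p U N n m = (blocked p U N n m).trace := by
  simp [fMPO, blocked, mpoSign_eq_blockSign]

/-- The parity operator on a pair of bonds. -/
def doubledZ (Z : Matrix ν ν ℂ) : Matrix (ν × ν) (ν × ν) ℂ := Z ⊗ₖ mconj Z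

lemma doubledZ_mul_self (hZ : Z * Z = 1) : doubledZ Z * doubledZ Z = 1 := by
  rw [doubledZ, ← Matrix.mul_kronecker_mul, ← mconj_mul, hZ, mconj_one, Matrix.one_kronecker_one]

lemma doubledZ_pow (x : ZMod 2) :
    doubledZ Z ^ x.val = (Z ^ x.val) ⊗ₖ mconj (Z ^ x.val) := by
  rcases zmod_two_cases x with rfl | rfl
  · simp [mconj_one]
  · simp [ZMod.val_one, doubledZ]

lemma star_sgn (x : ZMod 2) : star (sgn x) = sgn x := by simp [sgn]

lemma mconj_smul (c : ℂ) (M : Matrix ν ν ℂ) : mconj (c • M) = star c • mconj M := by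
  ext; simp [mconj]

lemma evenTensor_ladder (hU : EvenTensor (doubledP p) (doubledT U) Z) :
    EvenTensor (doubledP p) (doubledT (ladder U)) (doubledZ Z) := by
  rintro ⟨m, m'⟩
  simp only [doubledT, ladder, Finset.mul_sum, Finset.sum_mul, Finset.smul_sum]
  refine Finset.sum_congr rfl fun n _ => ?_
  have h1 := hU (n, m)
  have h2 := hU (n, m')
  simp only [doubledT, doubledP] at h1 h2 ⊢
  rw [doubledZ, ← Matrix.mul_kronecker_mul, ← mconj_mul, h1, h2, mconj_smul, star_sgn,
    ← Matrix.mul_kronecker_mul, ← mconj_mul, Matrix.smul_kronecker, Matrix.kronecker_smul,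
    smul_smul, ← sgn_add]
  congr 2
  linear_combination CharTwo.add_self_eq_zero (p n)

lemma ladder_blocked (hZ : Z * Z = 1) (hU : EvenTensor (doubledP p) (doubledT U) Z) {N : ℕ}
    {m m' : Fin N → ι} (h : ∑ j, p (m j) = ∑ j, p (m' j)) :
    ladder (blocked p U N) m m' =
      ladder (word (gauge p Z U) (N := N)) m m' * doubledZ Z ^ (∑ j, p (m j)).val := by
  rw [ladder, ladder, Finset.sum_mul]
  refine Finset.sum_congr rfl fun n _ => ?_
  rw [doubledZ_pow, ← Matrix.mul_kronecker_mul, ← mconj_mul, blocked_eq hZ hU, blocked_eq hZ hU, h]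

lemma trace_ladder_blocked {N : ℕ} (hN : fMPO p U N ∈ Matrix.unitaryGroup (Fin N → ι) ℂ)
    (m m' : Fin N → ι) : (ladder (blocked p U N) m m').trace = if m = m' then 1 else 0 := by
  have h1 := congrFun (congrFun (Matrix.mem_unitaryGroup_iff'.1 hN) m') m
  rw [trace_ladder]
  simp only [← fMPO_apply]
  rw [Matrix.mul_apply, Matrix.one_apply] at h1
  simp only [eq_comm (a := m), ← h1]
  refine Finset.sum_congr rfl fun n _ => ?_
  rw [Matrix.star_apply, mul_comm]

/-- The products of ladders with even total parity, corrected by the parity operator. -/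
def evenWords (p : ι → ZMod 2) (Z : Matrix ν ν ℂ) (V : ι → ι → Matrix ν ν ℂ) :
    Set (Matrix (ν × ν) (ν × ν) ℂ) :=
  {a | ∃ l : List (ι × ι), l ≠ [] ∧ (l.map (doubledP p)).sum = 0 ∧
    a = (l.map (doubledT (ladder V))).prod * doubledZ Z ^ (l.map fun x => p x.1).sum.val}

lemma evenTensor_scaled (c : ℂ) (hU : EvenTensor (doubledP p) (doubledT U) Z) :
    EvenTensor (doubledP p) (mpoScaled c U) Z := fun x => by
  have := hU x
  simp only [doubledT, mpoScaled] at *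
  rw [Matrix.mul_smul, this, Matrix.smul_mul, smul_comm]

lemma transfer_mpoScaled {c : ℂ} (hc : c * star c = (Fintype.card ι : ℂ)⁻¹) :
    transfer (mpoScaled c U) = meanLadder U := by
  rw [transfer, meanLadder, Fintype.sum_prod_type_right, ← hc, Finset.smul_sum]
  refine Finset.sum_congr rfl fun m _ => ?_
  rw [ladder, Finset.smul_sum]
  refine Finset.sum_congr rfl fun n _ => ?_
  rw [mpoScaled, mconj_smul, Matrix.smul_kronecker, Matrix.kronecker_smul, smul_smul]

lemma exists_mul_star_eq_inv (n : ℕ) : ((Real.sqrt n : ℂ))⁻¹ * star ((Real.sqrt n : ℂ))⁻¹ =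
    (n : ℂ)⁻¹ := by
  rw [star_inv₀, Complex.star_def, Complex.conj_ofReal, ← mul_inv, ← Complex.ofReal_mul,
    Real.mul_self_sqrt (Nat.cast_nonneg n), Complex.ofReal_natCast]

end Gauge

section Isometry

set_option linter.unusedSectionVars false

variable {ι ν : Type*} [Fintype ι] [DecidableEq ι] [Fintype ν] [DecidableEq ν]
  {p : ι → ZMod 2} {Z : Matrix ν ν ℂ} {U V : ι → ι → Matrix ν ν ℂ}

lemma EvenTensor.commute_list_prod {κ h : Type*} [Fintype h] [DecidableEq h] {W : Matrix h h ℂ}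
    {A : κ → Matrix h h ℂ} {p : κ → ZMod 2} (hA : EvenTensor p A W) {l : List κ}
    (hl : (l.map p).sum = 0) : Commute W (l.map A).prod := by
  have := hA.list_prod l
  rwa [hl, sgn_zero, one_smul] at this

lemma commute_of_mem_evenWords (hV : EvenTensor (doubledP p) (doubledT V) Z)
    {a : Matrix (ν × ν) (ν × ν) ℂ} (ha : a ∈ evenWords p Z V) : Commute (doubledZ Z) a := by
  obtain ⟨l, -, hl, rfl⟩ := ha
  exact ((evenTensor_ladder hV).commute_list_prod hl).mul_right (Commute.pow_right rfl _)

lemma trace_list_ladder (hZ : Z * Z = 1) (hU : EvenTensor (doubledP p) (doubledT U) Z)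
    (hunit : ∀ N : ℕ, 1 ≤ N → fMPO p U N ∈ Matrix.unitaryGroup (Fin N → ι) ℂ)
    {l : List (ι × ι)} (hl : l ≠ []) (hp : (l.map (doubledP p)).sum = 0) :
    ((l.map (doubledT (ladder (gauge p Z U)))).prod *
        doubledZ Z ^ (l.map fun x => p x.1).sum.val).trace =
      (l.map fun x => if x.1 = x.2 then (1 : ℂ) else 0).prod := by
  obtain ⟨N, f, rfl⟩ : ∃ (N : ℕ) (f : Fin N → ι × ι), l = List.ofFn f :=
    ⟨_, l.get, (List.ofFn_get l).symm⟩
  have hN : 1 ≤ N := by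
    rw [Ne, List.ofFn_eq_nil_iff] at hl; omega
  have h2 : ∑ j, p (f j).1 = ∑ j, p (f j).2 := by
    rw [List.map_ofFn, List.sum_ofFn] at hp
    simp only [Function.comp_apply, doubledP, Finset.sum_add_distrib] at hp
    exact CharTwo.add_eq_zero.1 hp
  have h1 := trace_ladder_blocked (hunit N hN) (fun j => (f j).1) (fun j => (f j).2)
  rw [ladder_blocked hZ hU h2, ← prod_ofFn_ladder] at h1
  rw [List.map_ofFn, List.map_ofFn, List.map_ofFn, List.sum_ofFn,
    List.prod_ofFn (f := (fun x : ι × ι => if x.1 = x.2 then (1 : ℂ) else 0) ∘ f)]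
  refine h1.trans ?_
  simp only [Function.comp_apply, Finset.prod_ite_zero, Finset.prod_const_one, funext_iff,
    Finset.mem_univ, true_imp_iff]

lemma isTraceMul_evenWords (hZ : Z * Z = 1) (hU : EvenTensor (doubledP p) (doubledT U) Z)
    (hunit : ∀ N : ℕ, 1 ≤ N → fMPO p U N ∈ Matrix.unitaryGroup (Fin N → ι) ℂ) :
    IsTraceMul (Submodule.span ℂ (evenWords p Z (gauge p Z U))) := by
  have hL := evenTensor_ladder (evenTensor_gauge hU)
  have key : ∀ l₁ l₂ : List (ι × ι), (l₁.map (doubledP p)).sum = 0 →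
      (l₂.map (doubledP p)).sum = 0 →
      (l₁.map (doubledT (ladder (gauge p Z U)))).prod *
          doubledZ Z ^ (l₁.map fun x => p x.1).sum.val *
        ((l₂.map (doubledT (ladder (gauge p Z U)))).prod *
          doubledZ Z ^ (l₂.map fun x => p x.1).sum.val) =
      ((l₁ ++ l₂).map (doubledT (ladder (gauge p Z U)))).prod *
          doubledZ Z ^ ((l₁ ++ l₂).map fun x => p x.1).sum.val := by
    intro l₁ l₂ _ h2
    rw [List.map_append, List.map_append, List.prod_append, List.sum_append,
      pow_val_add (doubledZ_mul_self hZ)]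
    have := ((hL.commute_list_prod h2).pow_left (l₁.map fun x => p x.1).sum.val).eq
    rw [mul_assoc, ← mul_assoc (doubledZ Z ^ _), this]
    noncomm_ring
  refine IsTraceMul.span ?_ ?_
  · rintro _ ⟨l₁, hn₁, h₁, rfl⟩ _ ⟨l₂, hn₂, h₂, rfl⟩
    refine ⟨l₁ ++ l₂, by simp [hn₁], by simp [h₁, h₂], key _ _ h₁ h₂⟩
  · rintro _ ⟨l₁, hn₁, h₁, rfl⟩ _ ⟨l₂, hn₂, h₂, rfl⟩
    rw [key _ _ h₁ h₂, trace_list_ladder hZ hU hunit hn₁ h₁, trace_list_ladder hZ hU hunit hn₂ h₂,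
      trace_list_ladder hZ hU hunit (by simp [hn₁]) (by simp [h₁, h₂]), List.map_append,
      List.prod_append]

lemma meanLadder_mem_span (hZ : Z * Z = 1) :
    meanLadder U ∈ Submodule.span ℂ (evenWords p Z (gauge p Z U)) := by
  refine Submodule.smul_mem _ _ (Submodule.sum_mem _ fun m _ => Submodule.subset_span
    ⟨[(m, m)], by simp, by simp [doubledP, CharTwo.add_self_eq_zero], ?_⟩)
  simp only [List.map_cons, List.map_nil, List.prod_singleton, List.sum_singleton, doubledT, ladder,
    gauge, Finset.sum_mul]
  refine Finset.sum_congr rfl fun n _ => ?_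
  rw [doubledZ_pow, ← Matrix.mul_kronecker_mul, ← mconj_mul, mul_assoc, pow_val_mul_self hZ,
    mul_one]

lemma trace_meanLadder_of_unitary [Nonempty ι]
    (hunit : fMPO p U 1 ∈ Matrix.unitaryGroup (Fin 1 → ι) ℂ) :
    (meanLadder U).trace = 1 := by
  have hb : ∀ n m : Fin 1 → ι, blockSign p n m = 0 := fun n m => Finset.sum_eq_zero fun x hx =>
    absurd (Finset.mem_filter.1 hx).2 (by simp [Subsingleton.elim x.1 x.2])
  have h1 : ∀ m, (ladder U m m).trace = 1 := fun m => by
    have := trace_ladder_blocked hunit (fun _ => m) (fun _ => m)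
    rw [if_pos rfl, trace_ladder] at this
    rw [← this, trace_ladder, ← (Equiv.funUnique (Fin 1) ι).symm.sum_comp]
    simp [blocked, hb, sgn_zero]
  rw [meanLadder, Matrix.trace_smul, Matrix.trace_sum]
  simp [h1]

lemma exists_meanLadder_pow [Nonempty ι] (hZ : Z * Z = 1)
    (hU : EvenTensor (doubledP p) (doubledT U) Z)
    (hunit : ∀ N : ℕ, 1 ≤ N → fMPO p U N ∈ Matrix.unitaryGroup (Fin N → ι) ℂ) :
    ∃ (N : ℕ) (r s : ν × ν → ℂ), meanLadder U ^ (N + 1) = vecMulVec r s ∧ s ⬝ᵥ r = 1 ∧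
      vecMulVec r s ∈ Submodule.span ℂ (evenWords p Z (gauge p Z U)) ∧
      meanLadder U * vecMulVec r s = vecMulVec r s :=
  (isTraceMul_evenWords hZ hU hunit).exists_pow_eq_vecMulVec (meanLadder_mem_span hZ)
    (trace_meanLadder_of_unitary (hunit 1 le_rfl))

lemma doubledZ_mul_vecMulVec (hZ : IsParityMatrix Z) {ρ : Matrix ν ν ℂ} (hρ : ρ * Z = Z * ρ)
    (s : ν × ν → ℂ) : doubledZ Z * vecMulVec (vecOf ρ) s = vecMulVec (vecOf ρ) s := by
  have h1 := transfer_mulVec (fun _ : Unit => Z) ρ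
  have h2 : transfer (fun _ : Unit => Z) = doubledZ Z := by simp [transfer, doubledZ]
  rw [h2] at h1
  rw [Matrix.mul_vecMulVec, h1]
  simp [hZ.conjTranspose_eq, ← hρ, mul_assoc, hZ.mul_self]

lemma trace_mul_doubledZ [Nonempty ι] (hZ : IsParityMatrix Z)
    (hU : EvenTensor (doubledP p) (doubledT U) Z)
    (hunit : ∀ N : ℕ, 1 ≤ N → fMPO p U N ∈ Matrix.unitaryGroup (Fin N → ι) ℂ)
    {b : Matrix (ν × ν) (ν × ν) ℂ}
    (hb : b ∈ Submodule.span ℂ (evenWords p Z (gauge p Z U))) :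
    (b * doubledZ Z).trace = b.trace := by
  have hB := isTraceMul_evenWords hZ.mul_self hU hunit
  obtain ⟨N, r, s, hE, hrs, hP, -⟩ := exists_meanLadder_pow hZ.mul_self hU hunit
  rw [← transfer_mpoScaled (exists_mul_star_eq_inv (Fintype.card ι))] at hE
  obtain ⟨ρ, τ, h1, -, -, hρ, -⟩ := exists_posSemidef_factors hZ (evenTensor_scaled _ hU) hE hrs
  set P := vecMulVec r s with hPdef
  have hPtr : P.trace = 1 := by rw [hPdef, Matrix.trace_vecMulVec, dotProduct_comm, hrs]
  have hPZ : (P * doubledZ Z).trace = 1 := by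
    rw [Matrix.trace_mul_comm, h1, doubledZ_mul_vecMulVec hZ hρ, ← h1, hPtr]
  have hcomm : Commute (doubledZ Z) (b - b.trace • P) := by
    have h0 : b - b.trace • P ∈ Submodule.span ℂ (evenWords p Z (gauge p Z U)) :=
      sub_mem hb (Submodule.smul_mem _ _ hP)
    clear_value P
    generalize b - b.trace • P = x at h0
    induction h0 using Submodule.span_induction with
    | mem x hx => exact commute_of_mem_evenWords (evenTensor_gauge hU) hx
    | zero => exact Commute.zero_right _
    | add x y _ _ hx hy => exact hx.add_right hy
    | smul c x _ hx => exact hx.smul_right c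
  have hnil : IsNilpotent (b - b.trace • P) :=
    hB.isNilpotent (sub_mem hb (Submodule.smul_mem _ _ hP)) (by simp [hPtr])
  have h3 : IsNilpotent ((b - b.trace • P) * doubledZ Z) :=
    hcomm.symm.isNilpotent_mul_right hnil
  have h4 := (Matrix.isNilpotent_trace_of_isNilpotent h3).eq_zero
  rw [sub_mul, Matrix.trace_sub, Matrix.smul_mul, Matrix.trace_smul, hPZ] at h4
  simpa [sub_eq_zero] using h4

lemma traceIsometric_gauge [Nonempty ι] (hZ : IsParityMatrix Z)
    (hU : EvenTensor (doubledP p) (doubledT U) Z)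
    (hunit : ∀ N : ℕ, 1 ≤ N → fMPO p U N ∈ Matrix.unitaryGroup (Fin N → ι) ℂ) :
    TraceIsometric (gauge p Z U) := by
  intro N hN m m'
  have hΘ := doubledZ_mul_self hZ.mul_self
  rw [← trace_ladder]
  by_cases h : ∑ j, p (m j) = ∑ j, p (m' j)
  · rw [← trace_ladder_blocked (hunit N hN), ladder_blocked hZ.mul_self hU h]
    rcases zmod_two_cases (∑ j, p (m j)) with hx | hx
    · simp [hx]
    · have := trace_mul_doubledZ hZ hU hunit (b := ladder (blocked p U N) m m')
        (Submodule.subset_span ⟨List.ofFn fun j => (m j, m' j), ?_, ?_, ?_⟩)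
      · rw [ladder_blocked hZ.mul_self hU h, hx, ZMod.val_one, pow_one, mul_assoc, hΘ,
          mul_one] at this
        rw [hx, ZMod.val_one, pow_one, this]
      · rw [Ne, List.ofFn_eq_nil_iff]; omega
      · rw [List.map_ofFn, List.sum_ofFn]
        simp only [Function.comp_apply, doubledP, Finset.sum_add_distrib, h,
          CharTwo.add_self_eq_zero]
      · rw [ladder_blocked hZ.mul_self hU h, List.map_ofFn, List.map_ofFn, List.sum_ofFn,
          ← prod_ofFn_ladder]
        rfl
  · have hne : m ≠ m' := fun h' => h (by rw [h'])
    have hs : ∑ j, p (m j) + ∑ j, p (m' j) = 1 :=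
      (zmod_two_cases _).resolve_left fun h' => h (CharTwo.add_eq_zero.1 h')
    have h1 := evenTensor_ladder (evenTensor_word (evenTensor_gauge hU) N) (m, m')
    simp only [doubledT, doubledP, hs] at h1
    have h2 := congrArg (fun M => (doubledZ Z * M).trace) h1
    rw [← mul_assoc, hΘ, one_mul, Matrix.mul_smul, Matrix.trace_smul, Matrix.trace_mul_comm,
      mul_assoc, hΘ, mul_one] at h2
    have h3 : sgn 1 = -1 := by simp [sgn, ZMod.val_one]
    rw [h3, smul_eq_mul, neg_one_mul, self_eq_neg] at h2
    rw [h2, if_neg hne]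

lemma TraceIsometric.swap (hV : TraceIsometric V) : TraceIsometric fun a b => V b a := by
  intro N hN m m'
  set T : Matrix (Fin N → ι) (Fin N → ι) ℂ := Matrix.of fun n m => (word V n m).trace with hT
  have h1 : Tᵀ * T.map star = 1 := by
    ext a b
    rw [Matrix.mul_apply, Matrix.one_apply, ← hV N hN a b]
    simp [hT]
  have h2 : T.map star * Tᵀ = 1 := mul_eq_one_comm.1 h1
  have h3 := congrFun (congrFun h2 m') m
  rw [Matrix.mul_apply, Matrix.one_apply] at h3
  simp only [eq_comm (a := m), ← h3]
  refine Finset.sum_congr rfl fun n _ => ?_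
  simp [hT, word, mul_comm]

end Isometry

section Ranks

set_option linter.unusedSectionVars false

variable {ι κ ν ν' : Type*} [Fintype ι] [DecidableEq ι] [Fintype κ] [DecidableEq κ]
  [Fintype ν] [DecidableEq ν] [Fintype ν'] [DecidableEq ν']

lemma rank_mul_diagonal {m n : Type*} [Fintype m] [Fintype n] [DecidableEq n] (A : Matrix m n ℂ)
    {c : n → ℂ} (hc : ∀ i, c i ≠ 0) : (A * diagonal c).rank = A.rank := by
  refine Matrix.rank_mul_eq_left_of_isUnit_det _ _ ?_
  rw [Matrix.det_diagonal, isUnit_iff_ne_zero]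
  exact Finset.prod_ne_zero_iff.2 fun i _ => hc i

lemma IsParityMatrix.diag_ne_zero {Z : Matrix ν ν ℂ} (hZ : IsParityMatrix Z) (α : ν) :
    Z α α ≠ 0 := by
  rcases hZ.2 α with h | h <;> simp [h]

lemma IsParityMatrix.mul_pow_apply {Z : Matrix ν ν ℂ} (hZ : IsParityMatrix Z) (M : Matrix ν ν ℂ)
    (k : ℕ) (α β : ν) : (M * Z ^ k) α β = M α β * Z β β ^ k := by
  obtain ⟨z, rfl, -⟩ := hZ.exists_eq_diagonal
  rw [Matrix.diagonal_pow, Matrix.mul_diagonal]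
  simp

lemma leftRank_gauge {p : κ → ZMod 2} {Z : Matrix ν ν ℂ} (hZ : IsParityMatrix Z)
    (W : κ → κ → Matrix ν ν ℂ) : leftRank (gauge p Z W) = (leftMat W).rank := by
  refine Eq.trans (congrArg Matrix.rank ?_) (rank_mul_diagonal (leftMat W)
    (c := fun x => Z x.2 x.2 ^ (p x.1).val) fun x => pow_ne_zero _ (hZ.diag_ne_zero _))
  ext r c
  simp [leftMat, gauge, hZ.mul_pow_apply]

lemma rightRank_gauge {p : κ → ZMod 2} {Z : Matrix ν ν ℂ} (hZ : IsParityMatrix Z)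
    {W : κ → κ → Matrix ν ν ℂ} (hW : EvenTensor (doubledP p) (doubledT W) Z) :
    rightRank p (gauge p Z W) = (leftMat fun n m => (W n m)ᵀ).rank := by
  have hs : ∀ x, sgn x ≠ 0 := fun x => by simp [sgn]
  refine Eq.trans (congrArg Matrix.rank ?_) (rank_mul_diagonal (leftMat fun n m => (W n m)ᵀ)
    (c := fun x => sgn (p x.1) * Z x.2 x.2 ^ (p x.1).val)
    fun x => mul_ne_zero (hs _) (pow_ne_zero _ (hZ.diag_ne_zero _)))
  ext ⟨n, β⟩ ⟨m, α⟩
  have h1 := congrFun (congrFun (hW (n, m)) α) β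
  simp only [leftMat, gauge, hZ.mul_pow_apply, Matrix.of_apply, Matrix.mul_diagonal,
    Matrix.transpose_apply]
  rcases zmod_two_cases (p m) with h | h
  · simp [h, sgn_zero]
  · simp only [doubledT, doubledP, Matrix.smul_apply, smul_eq_mul] at h1
    have h2 : (Z * W n m) α β = Z α α * W n m α β := by
      obtain ⟨z, rfl, -⟩ := hZ.exists_eq_diagonal
      simp
    have h3 : (W n m * Z) α β = W n m α β * Z β β := by
      simpa using hZ.mul_pow_apply (W n m) 1 α β
    rw [h2, h3, sgn_add, h] at h1
    simp only [h, mul_one, ZMod.val_one, pow_one]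
    linear_combination (-sgn 1) * h1 + (-sgn (p n) * W n m α β * Z β β) * sgn_mul_self 1

lemma leftMat_mul_mul (K : Matrix ν ν' ℂ) (L : Matrix ν' ν ℂ) (Y : κ → κ → Matrix ν' ν' ℂ) :
    leftMat (fun n m => K * Y n m * L) =
      ((1 : Matrix κ κ ℂ) ⊗ₖ K) * leftMat Y * ((1 : Matrix κ κ ℂ) ⊗ₖ L) := by
  ext ⟨n, α⟩ ⟨m, β⟩
  simp [leftMat, Matrix.mul_apply, Fintype.sum_prod_type, Matrix.one_apply, ite_mul,
    Finset.sum_mul]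

lemma rank_leftMat_mul_mul {K : Matrix ν ν' ℂ} {L : Matrix ν' ν ℂ} {K' : Matrix ν' ν ℂ}
    {L' : Matrix ν ν' ℂ} (hK : K' * K = 1) (hL : L * L' = 1) (Y : κ → κ → Matrix ν' ν' ℂ) :
    (leftMat fun n m => K * Y n m * L).rank = (leftMat Y).rank := by
  refine le_antisymm ?_ ?_
  · rw [leftMat_mul_mul]
    exact (Matrix.rank_mul_le_left _ _).trans (Matrix.rank_mul_le_right _ _)
  · have h : Y = fun n m => K' * (K * Y n m * L) * L' := by
      ext1 n; ext1 m
      rw [Matrix.mul_assoc, Matrix.mul_assoc, hL, Matrix.mul_one, ← Matrix.mul_assoc, hK,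
        Matrix.one_mul]
    conv_lhs => rw [h, leftMat_mul_mul]
    exact (Matrix.rank_mul_le_left _ _).trans (Matrix.rank_mul_le_right _ _)

lemma rank_leftMat_mul_le (V : ι → ι → Matrix ν ν ℂ) (W : κ → κ → Matrix ν ν ℂ) :
    (leftMat fun x y : ι × κ => V x.1 y.1 * W x.2 y.2).rank ≤
      Fintype.card ι * (leftMat W).rank := by
  have h : (leftMat fun x y : ι × κ => V x.1 y.1 * W x.2 y.2) =
      (Matrix.of fun (r : (ι × κ) × ν) (c : ι × (κ × ν)) =>
        if r.1.2 = c.2.1 then V r.1.1 c.1 r.2 c.2.2 else 0) *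
      ((1 : Matrix ι ι ℂ) ⊗ₖ leftMat W).submatrix id (Equiv.prodAssoc ι κ ν) := by
    ext ⟨⟨a, n⟩, α⟩ ⟨⟨b, m⟩, β⟩
    simp [leftMat, Matrix.mul_apply, Fintype.sum_prod_type, Matrix.one_apply, ite_mul]
  rw [h]
  refine (Matrix.rank_mul_le_right _ _).trans ?_
  rw [← Equiv.coe_refl, Matrix.rank_submatrix, rank_kronecker, Matrix.rank_one]

lemma rank_leftMat_transpose (X : κ → κ → Matrix ν ν ℂ) :
    (leftMat fun n m => (X m n)ᵀ).rank = (leftMat X).rank := by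
  rw [← Matrix.rank_transpose (leftMat X)]
  rfl

lemma rank_leftMat_mul_le' (V : ι → ι → Matrix ν ν ℂ) (W : κ → κ → Matrix ν ν ℂ) :
    (leftMat fun x y : ι × κ => W x.2 y.2 * V x.1 y.1).rank ≤
      Fintype.card ι * (leftMat W).rank := by
  rw [← rank_leftMat_transpose, ← rank_leftMat_transpose W]
  simp only [Matrix.transpose_mul]
  exact rank_leftMat_mul_le (fun a b => (V b a)ᵀ) fun n m => (W m n)ᵀ

lemma rank_leftMat_comp (e : ι ≃ κ) (X : κ → κ → Matrix ν ν ℂ) :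
    (leftMat fun a b => X (e a) (e b)).rank = (leftMat X).rank := by
  rw [← Matrix.rank_submatrix (leftMat X) (e.prodCongr (Equiv.refl ν))
    (e.prodCongr (Equiv.refl ν))]
  rfl

lemma rank_leftMat_word_succ_le (V : ι → ι → Matrix ν ν ℂ) (q : ℕ) :
    (leftMat (word V (N := q + 1))).rank ≤ Fintype.card ι * (leftMat (word V (N := q))).rank := by
  rw [← rank_leftMat_comp (Fin.consEquiv fun _ : Fin (q + 1) => ι)]
  refine le_of_eq_of_le ?_ (rank_leftMat_mul_le V (word V (N := q)))
  congr 2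
  ext1 x; ext1 y
  exact word_cons V x.1 y.1 x.2 y.2

lemma rank_leftMat_word_transpose_succ_le (V : ι → ι → Matrix ν ν ℂ) (q : ℕ) :
    (leftMat fun n m => (word V (N := q + 1) n m)ᵀ).rank ≤
      Fintype.card ι * (leftMat fun n m => (word V (N := q) n m)ᵀ).rank := by
  rw [← rank_leftMat_comp (Fin.consEquiv fun _ : Fin (q + 1) => ι)]
  refine le_of_eq_of_le ?_ (rank_leftMat_mul_le' (fun a b => (V a b)ᵀ)
    fun n m => (word V (N := q) n m)ᵀ)
  congr 2
  ext1 x; ext1 y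
  rw [← Matrix.transpose_mul]
  exact congrArg _ (word_cons V x.1 y.1 x.2 y.2)

end Ranks

section Blocks

set_option linter.unusedSectionVars false

variable {ι ν ν' : Type*} [Fintype ι] [DecidableEq ι] [Fintype ν] [DecidableEq ν]
  [Fintype ν'] [DecidableEq ν']

lemma conjTranspose_mul_word {V : ι → ι → Matrix ν ν ℂ} {V' : ι → ι → Matrix ν' ν' ℂ}
    {J : Matrix ν ν' ℂ} (hJ : Jᴴ * J = 1) (h : ∀ n m, V n m = J * V' n m * Jᴴ) {N : ℕ}
    (n m : Fin N → ι) : Jᴴ * word V n m = word V' n m * Jᴴ := by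
  induction N with
  | zero => simp [word]
  | succ N ih =>
    obtain ⟨a, n, rfl⟩ : ∃ a x, n = Fin.cons a x := ⟨n 0, Fin.tail n, (Fin.cons_self_tail n).symm⟩
    obtain ⟨b, m, rfl⟩ : ∃ a x, m = Fin.cons a x := ⟨m 0, Fin.tail m, (Fin.cons_self_tail m).symm⟩
    rw [word_cons, word_cons, h, Matrix.mul_assoc (V' a b), ← ih, ← Matrix.mul_assoc,
      ← Matrix.mul_assoc, ← Matrix.mul_assoc, hJ, Matrix.one_mul, Matrix.mul_assoc]

lemma word_eq_of_isometry {V : ι → ι → Matrix ν ν ℂ} {V' : ι → ι → Matrix ν' ν' ℂ}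
    {J : Matrix ν ν' ℂ} (hJ : Jᴴ * J = 1) (h : ∀ n m, V n m = J * V' n m * Jᴴ) {N : ℕ}
    (hN : 1 ≤ N) (n m : Fin N → ι) : word V n m = J * word V' n m * Jᴴ := by
  obtain ⟨N, rfl⟩ := Nat.exists_eq_add_of_le' hN
  obtain ⟨a, n, rfl⟩ : ∃ a x, n = Fin.cons a x := ⟨n 0, Fin.tail n, (Fin.cons_self_tail n).symm⟩
  obtain ⟨b, m, rfl⟩ : ∃ a x, m = Fin.cons a x := ⟨m 0, Fin.tail m, (Fin.cons_self_tail m).symm⟩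
  rw [word_cons, word_cons, h, Matrix.mul_assoc, conjTranspose_mul_word hJ h]
  simp only [Matrix.mul_assoc]

lemma TraceIsometric.of_isometry {V : ι → ι → Matrix ν ν ℂ} {V' : ι → ι → Matrix ν' ν' ℂ}
    {J : Matrix ν ν' ℂ} (hV : TraceIsometric V) (hJ : Jᴴ * J = 1)
    (h : ∀ n m, V n m = J * V' n m * Jᴴ) : TraceIsometric V' := by
  have htr : ∀ {N : ℕ}, 1 ≤ N → ∀ n m : Fin N → ι, (word V n m).trace = (word V' n m).trace := by
    intro N hN n m
    rw [word_eq_of_isometry hJ h hN, Matrix.trace_mul_comm, ← Matrix.mul_assoc, hJ, Matrix.one_mul]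
  intro N hN m m'
  simp only [← htr hN, hV N hN]

lemma gauge_eq_of_isometry {p : ι → ZMod 2} {U : ι → ι → Matrix ν ν ℂ} {Z : Matrix ν ν ℂ}
    {U' : ι → ι → Matrix ν' ν' ℂ} {Z' : Matrix ν' ν' ℂ} {J : Matrix ν ν' ℂ} (hZ : Zᴴ = Z)
    (hZ' : Z'ᴴ = Z') (hZJ : Z * J = J * Z') (h : ∀ n m, U n m = J * U' n m * Jᴴ) (n m : ι) :
    gauge p Z U n m = J * gauge p Z' U' n m * Jᴴ := by
  have h1 : Jᴴ * Z = Z' * Jᴴ := by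
    simpa [Matrix.conjTranspose_mul, hZ, hZ'] using congrArg Matrix.conjTranspose hZJ
  have h2 : Jᴴ * Z ^ (p m).val = Z' ^ (p m).val * Jᴴ := by
    rcases zmod_two_cases (p m) with hx | hx
    · simp [hx]
    · simpa [hx, ZMod.val_one] using h1
  rw [gauge, gauge, h, Matrix.mul_assoc, h2]
  simp only [Matrix.mul_assoc]

lemma GradedIrreducible.smul {κ : Type*} {A : κ → Matrix ν ν ℂ} {Z : Matrix ν ν ℂ}
    (hA : GradedIrreducible A Z) {c : ℂ} (hc : c ≠ 0) :
    GradedIrreducible (fun i => c • A i) Z := by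
  rintro ⟨P, h1, h2, h3, h4, h5, h6⟩
  refine hA ⟨P, h1, h2, h3, h4, h5, fun i => ?_⟩
  have := h6 i
  rw [Matrix.smul_mul, Matrix.mul_smul] at this
  exact smul_right_injective _ hc this

lemma GradedIrreducible.gauge {p : ι → ZMod 2} {U : ι → ι → Matrix ν ν ℂ} {Z : Matrix ν ν ℂ}
    (hZ : Z * Z = 1) (hU : GradedIrreducible (doubledT U) Z) :
    GradedIrreducible (doubledT (gauge p Z U)) Z := by
  rintro ⟨P, h1, h2, h3, h4, h5, h6⟩
  refine hU ⟨P, h1, h2, h3, h4, h5, fun i => ?_⟩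
  have h := h6 i
  have hc : Z ^ (p i.2).val * P = P * Z ^ (p i.2).val := ((show Commute P Z from h5).pow_right _).symm
  simp only [doubledT, FQCA.gauge] at h ⊢
  have e : U i.1 i.2 * Z ^ (p i.2).val * P * Z ^ (p i.2).val = U i.1 i.2 * P := by
    rw [mul_assoc (U i.1 i.2), hc, mul_assoc (U i.1 i.2), mul_assoc P, pow_val_mul_self hZ, mul_one]
  rw [← e, ← mul_assoc P, ← h]

end Blocks

section CanonicalForm

set_option linter.unusedSectionVars false

variable {ι ν : Type*} [Fintype ι] [DecidableEq ι] [Fintype ν] [DecidableEq ν]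

/-- The isometric inclusion of a block. -/
def blockIncl {g : ℕ} {Dk : Fin g → ℕ} (e : ν ≃ ((k : Fin g) × Fin (Dk k))) (k : Fin g) :
    Matrix ν (Fin (Dk k)) ℂ :=
  (1 : Matrix ((k : Fin g) × Fin (Dk k)) ((k : Fin g) × Fin (Dk k)) ℂ).submatrix e fun i => ⟨k, i⟩

section BlockIncl

variable {g : ℕ} {Dk : Fin g → ℕ} (e : ν ≃ ((k : Fin g) × Fin (Dk k)))

lemma blockIncl_conjTranspose_mul_self (k : Fin g) : (blockIncl e k)ᴴ * blockIncl e k = 1 := by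
  rw [blockIncl, Matrix.conjTranspose_submatrix, Matrix.submatrix_mul_equiv, Matrix.conjTranspose_one,
    Matrix.one_mul, Matrix.submatrix_one _ sigma_mk_injective]

lemma blockIncl_conjTranspose_mul {k l : Fin g} (h : k ≠ l) :
    (blockIncl e k)ᴴ * blockIncl e l = 0 := by
  rw [blockIncl, blockIncl, Matrix.conjTranspose_submatrix, Matrix.submatrix_mul_equiv,
    Matrix.conjTranspose_one, Matrix.one_mul]
  ext i j
  simp [h]

lemma sum_blockIncl_mul_conjTranspose :
    ∑ k, blockIncl e k * (blockIncl e k)ᴴ = 1 := by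
  ext α β
  simp only [Matrix.sum_apply, Matrix.mul_apply, blockIncl, Matrix.submatrix_apply,
    Matrix.conjTranspose_apply]
  rw [← Fintype.sum_sigma' (fun (k : Fin g) (i : Fin (Dk k)) =>
    (1 : Matrix ((k : Fin g) × Fin (Dk k)) ((k : Fin g) × Fin (Dk k)) ℂ) (e α) ⟨k, i⟩ *
    star ((1 : Matrix ((k : Fin g) × Fin (Dk k)) ((k : Fin g) × Fin (Dk k)) ℂ) (e β) ⟨k, i⟩))]
  simp [Matrix.one_apply, e.apply_eq_iff_eq, eq_comm]

lemma mul_blockIncl {M : Matrix ν ν ℂ} {B : (k : Fin g) → Matrix (Fin (Dk k)) (Fin (Dk k)) ℂ}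
    (h : Matrix.reindex e e M = Matrix.blockDiagonal' B) (k : Fin g) :
    M * blockIncl e k = blockIncl e k * B k := by
  obtain rfl : M = (Matrix.blockDiagonal' B).submatrix e e := by
    rw [← h]; ext; simp
  rw [blockIncl, Matrix.submatrix_mul_equiv, Matrix.mul_one]
  ext α j
  simp only [Matrix.submatrix_apply, Matrix.mul_apply]
  generalize e α = x
  obtain ⟨l, i⟩ := x
  by_cases hlk : l = k
  · subst hlk
    simp [Matrix.one_apply]
  · rw [Matrix.blockDiagonal'_apply_ne _ _ _ hlk, eq_comm]
    exact Finset.sum_eq_zero fun x _ => by simp [hlk]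

lemma le_card_of_sigma_equiv (e : ν ≃ ((k : Fin g) × Fin (Dk k))) (k : Fin g) : Dk k ≤ Fintype.card ν := by
  rw [Fintype.card_congr e, Fintype.card_sigma]
  simpa using Finset.single_le_sum (f := Dk) (fun _ _ => Nat.zero_le _) (Finset.mem_univ k)

end BlockIncl

lemma exists_fixed_of_gradedNormal {κ : Type*} [Fintype κ] {A : κ → Matrix ν ν ℂ}
    {Z : Matrix ν ν ℂ} (hA : GradedNormal A Z 1 ∨ GradedNormal A Z 2) :
    ∃ M : Matrix ν ν ℂ, M ≠ 0 ∧ ∑ i, A i * M * (A i)ᴴ = M := by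
  have h1 : (Matrix.charpoly (transfer A)).rootMultiplicity 1 ≠ 0 := by
    rcases hA with h | h <;> rw [h.2.1] <;> norm_num
  have h2 : (Matrix.charpoly (transfer A)).IsRoot 1 :=
    (Polynomial.rootMultiplicity_pos (Matrix.charpoly_monic _).ne_zero).1 (Nat.pos_of_ne_zero h1)
  rw [← Matrix.mem_spectrum_iff_isRoot_charpoly, ← Matrix.spectrum_toLin',
    ← Module.End.hasEigenvalue_iff_mem_spectrum] at h2
  obtain ⟨u, hu⟩ := h2.exists_hasEigenvector
  have h3 : transfer A *ᵥ u = u := by simpa using hu.apply_eq_smul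
  have h4 : vecOf (Matrix.of fun a b => u (a, b)) = u := rfl
  refine ⟨Matrix.of fun a b => u (a, b), fun h => hu.2 ?_, vecOf_injective ?_⟩
  · rw [← h4, h]; rfl
  · rw [← transfer_mulVec, h4, h3]

/-- If a power of the transfer matrix has rank one, its eigenvectors with nonzero eigenvalue are
proportional. -/
lemma exists_eq_smul_of_transfer_pow {κ : Type*} [Fintype κ] {A : κ → Matrix ν ν ℂ} {N : ℕ}
    {r s : ν × ν → ℂ} (hE : transfer A ^ (N + 1) = vecMulVec r s) {M M' : Matrix ν ν ℂ} {c c' : ℂ}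
    (hc : c ≠ 0) (hc' : c' ≠ 0) (hM : ∑ i, A i * M * (A i)ᴴ = c • M)
    (hM' : ∑ i, A i * M' * (A i)ᴴ = c' • M') (hM0 : M ≠ 0) : ∃ x : ℂ, M' = x • M := by
  have key : ∀ {M : Matrix ν ν ℂ} {c : ℂ}, c ≠ 0 → ∑ i, A i * M * (A i)ᴴ = c • M →
      ∃ x : ℂ, vecOf M = x • r := by
    intro M c hc hM
    have h1 : transfer A *ᵥ vecOf M = c • vecOf M := by rw [transfer_mulVec, hM]; rfl
    have h2 : ∀ k : ℕ, transfer A ^ k *ᵥ vecOf M = c ^ k • vecOf M := by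
      intro k
      induction k with
      | zero => simp
      | succ k ih => rw [pow_succ, ← Matrix.mulVec_mulVec, h1, Matrix.mulVec_smul, ih, smul_smul,
          pow_succ']
    have h3 := h2 (N + 1)
    rw [hE, Matrix.vecMulVec_mulVec] at h3
    refine ⟨(c ^ (N + 1))⁻¹ * (s ⬝ᵥ vecOf M), ?_⟩
    rw [mul_smul, eq_inv_smul_iff₀ (pow_ne_zero _ hc), ← h3]
    simp
  obtain ⟨x, hx⟩ := key hc hM
  obtain ⟨y, hy⟩ := key hc' hM'
  have hx0 : x ≠ 0 := by
    rintro rfl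
    exact hM0 (vecOf_injective (by rw [hx, zero_smul]; rfl))
  refine ⟨y * x⁻¹, vecOf_injective ?_⟩
  change vecOf M' = (y * x⁻¹) • vecOf M
  rw [hx, hy, smul_smul, mul_assoc, inv_mul_cancel₀ hx0, mul_one]

end CanonicalForm

section Reduction

set_option linter.unusedSectionVars false

variable {ι ν : Type*} [Fintype ι] [DecidableEq ι] [Fintype ν] [DecidableEq ν]
  {p : ι → ZMod 2} {Z : Matrix ν ν ℂ} {U : ι → ι → Matrix ν ν ℂ}

/-- A tensor in graded canonical form generating fMPUs has a single block of nonzero weight. -/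
lemma exists_irreducible_block [Nonempty ι] (hZ : Z * Z = 1)
    (hU : EvenTensor (doubledP p) (doubledT U) Z)
    (hunit : ∀ N : ℕ, 1 ≤ N → fMPO p U N ∈ Matrix.unitaryGroup (Fin N → ι) ℂ) {c : ℂ}
    (hc : c * star c = (Fintype.card ι : ℂ)⁻¹)
    (hGCF : GCF (doubledP p) (mpoScaled c U) Z) :
    ∃ (D' : ℕ) (J : Matrix ν (Fin D') ℂ) (Z' : Matrix (Fin D') (Fin D') ℂ)
      (U' : ι → ι → Matrix (Fin D') (Fin D') ℂ), D' ≤ Fintype.card ν ∧ Jᴴ * J = 1 ∧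
      IsParityMatrix Z' ∧ EvenTensor (doubledP p) (doubledT U') Z' ∧
      GradedIrreducible (doubledT U') Z' ∧ Z * J = J * Z' ∧
      ∀ n m, U n m = J * U' n m * Jᴴ := by
  obtain ⟨g, Dk, e, μ, Ak, Zk, -, hA, hZk, hk⟩ := hGCF
  obtain ⟨N, r, s, hE, hrs, -, -⟩ := exists_meanLadder_pow hZ hU hunit
  have hE1 := trace_meanLadder_of_unitary (hunit 1 le_rfl)
  rw [← transfer_mpoScaled hc] at hE hE1
  have hc0 : c ≠ 0 := by
    rintro rfl
    simp [eq_comm] at hc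
  set J := blockIncl e with hJ
  have hJJ : ∀ k, (J k)ᴴ * J k = 1 := blockIncl_conjTranspose_mul_self e
  have hAJ : ∀ i k, mpoScaled c U i * J k = J k * (μ k • Ak k i) := fun i k =>
    mul_blockIncl e (hA i) k
  have hdec : ∀ i, mpoScaled c U i = ∑ k, J k * (μ k • Ak k i) * (J k)ᴴ := by
    intro i
    simp only [← hAJ, Matrix.mul_assoc, ← Matrix.mul_sum]
    rw [hJ, sum_blockIncl_mul_conjTranspose, mul_one]
  have hne : ∃ k, μ k ≠ 0 := by
    by_contra! h
    have h0 : ∀ i, mpoScaled c U i = 0 := fun i => by simp [hdec, h]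
    rw [transfer] at hE1
    simp [h0] at hE1
  obtain ⟨k, hμ⟩ := hne
  have huniq : ∀ l, l ≠ k → μ l = 0 := by
    intro l hl
    by_contra hμl
    have hfix : ∀ l, ∃ M : Matrix (Fin (Dk l)) (Fin (Dk l)) ℂ, M ≠ 0 ∧
        ∑ i, mpoScaled c U i * (J l * M * (J l)ᴴ) * (mpoScaled c U i)ᴴ =
          (μ l * star (μ l)) • (J l * M * (J l)ᴴ) := by
      intro l
      obtain ⟨M, hM0, hM⟩ := exists_fixed_of_gradedNormal (hk l).2.2
      refine ⟨M, hM0, ?_⟩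
      have hterm : ∀ i, mpoScaled c U i * (J l * M * (J l)ᴴ) * (mpoScaled c U i)ᴴ =
          (μ l * star (μ l)) • (J l * (Ak l i * M * (Ak l i)ᴴ) * (J l)ᴴ) := by
        intro i
        have h1 : (J l)ᴴ * (mpoScaled c U i)ᴴ = star (μ l) • ((Ak l i)ᴴ * (J l)ᴴ) := by
          rw [← Matrix.conjTranspose_mul, hAJ, Matrix.conjTranspose_mul, Matrix.conjTranspose_smul,
            Matrix.smul_mul]
        rw [← Matrix.mul_assoc, ← Matrix.mul_assoc, hAJ, Matrix.mul_assoc, h1]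
        simp only [Matrix.mul_smul, Matrix.smul_mul, smul_smul, Matrix.mul_assoc, mul_comm]
      simp only [hterm]
      rw [← Finset.smul_sum, ← Matrix.sum_mul, ← Matrix.mul_sum, hM]
    obtain ⟨M, hM0, hM⟩ := hfix k
    obtain ⟨M', hM0', hM'⟩ := hfix l
    have hstar : ∀ l, μ l ≠ 0 → μ l * star (μ l) ≠ 0 := fun l h => mul_ne_zero h (star_ne_zero.2 h)
    have hback : ∀ l (M : Matrix (Fin (Dk l)) (Fin (Dk l)) ℂ),
        (J l)ᴴ * (J l * M * (J l)ᴴ) * J l = M := by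
      intro l M
      rw [← Matrix.mul_assoc, ← Matrix.mul_assoc, hJJ, Matrix.one_mul, Matrix.mul_assoc, hJJ,
        Matrix.mul_one]
    obtain ⟨x, hx⟩ := exists_eq_smul_of_transfer_pow hE (hstar _ hμ) (hstar _ hμl) hM hM'
      fun h => hM0 (by rw [← hback k M, h]; simp)
    refine hM0' ?_
    rw [← hback l M', hx, Matrix.mul_smul, ← Matrix.mul_assoc, ← Matrix.mul_assoc,
      hJ, blockIncl_conjTranspose_mul e hl]
    simp
  refine ⟨Dk k, J k, Zk k, fun n m => (c⁻¹ * μ k) • Ak k (n, m), le_card_of_sigma_equiv e k, hJJ k,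
    (hk k).1, ?_, ?_, mul_blockIncl e hZk k, ?_⟩
  · intro i
    have := (hk k).2.1 i
    simp only [doubledT]
    rw [Matrix.mul_smul, this, Matrix.smul_mul, smul_comm]
  · have : GradedIrreducible (Ak k) (Zk k) := by
      rcases (hk k).2.2 with h | h <;> exact h.1
    exact this.smul (mul_ne_zero (inv_ne_zero hc0) hμ)
  · intro n m
    have h1 := hdec (n, m)
    rw [Finset.sum_eq_single k (fun l _ hl => by simp [huniq l hl]) (by simp)] at h1
    beta_reduce
    rw [mul_smul, Matrix.mul_smul, Matrix.smul_mul, ← h1, mpoScaled, inv_smul_smul₀ hc0]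

end Reduction

section Index

set_option linter.unusedSectionVars false

variable {ι ν : Type*} [Fintype ι] [DecidableEq ι] [Fintype ν] [DecidableEq ν]
  {p : ι → ZMod 2} {Z : Matrix ν ν ℂ} {U V : ι → ι → Matrix ν ν ℂ}

lemma TraceIsometric.rank_mul_rank [Nonempty ι] (hV : TraceIsometric V) (hZ : IsParityMatrix Z)
    (hE : EvenTensor (doubledP p) (doubledT V) Z) (hirr : GradedIrreducible (doubledT V) Z) {q : ℕ}
    (hq1 : 1 ≤ q) (hq : Fintype.card (ν × ν) ≤ q) :
    (leftMat fun n k => (word V (N := q) n k)ᵀ).rank * (leftMat (word V (N := q))).rank =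
      Fintype.card ι ^ (2 * q) := by
  obtain ⟨N, r, s, hr, hrs, -, hEP⟩ := hV.isTraceMul.exists_pow_eq_vecMulVec (meanLadder_mem V)
    hV.trace_meanLadder
  have hc := exists_mul_star_eq_inv (Fintype.card ι)
  set c : ℂ := ((Real.sqrt (Fintype.card ι) : ℂ))⁻¹
  have hc0 : c ≠ 0 := by
    intro h
    simp [h, eq_comm] at hc
  rw [← transfer_mpoScaled hc] at hr hEP
  obtain ⟨ρ, σ, hP, hρ, hσ⟩ := exists_posDef_factors hZ (evenTensor_scaled c hE) (hirr.smul hc0)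
    hr hrs hEP
  rw [transfer_mpoScaled hc, hP] at hr
  refine rank_mul_rank_word hV hV.swap hρ hσ hr ?_ hq1 hq
  rw [dotProduct_comm, ← Matrix.trace_vecMulVec, ← hP, Matrix.trace_vecMulVec, dotProduct_comm, hrs]

lemma rank_mul_rank_gauge [Nonempty ι] (hZ : IsParityMatrix Z)
    (hU : EvenTensor (doubledP p) (doubledT U) Z)
    (hunit : ∀ N : ℕ, 1 ≤ N → fMPO p U N ∈ Matrix.unitaryGroup (Fin N → ι) ℂ) {c : ℂ}
    (hc : c * star c = (Fintype.card ι : ℂ)⁻¹)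
    (hGCF : GCF (doubledP p) (mpoScaled c U) Z) {q : ℕ} (hq1 : 1 ≤ q)
    (hq : Fintype.card ν ^ 2 ≤ q) :
    (leftMat fun n k => (word (gauge p Z U) (N := q) n k)ᵀ).rank *
      (leftMat (word (gauge p Z U) (N := q))).rank = Fintype.card ι ^ (2 * q) := by
  obtain ⟨D', J, Z', U', hD', hJ, hZ', hU', hirr, hZJ, h⟩ :=
    exists_irreducible_block hZ.mul_self hU hunit hc hGCF
  have hV := gauge_eq_of_isometry (p := p) hZ.conjTranspose_eq hZ'.conjTranspose_eq hZJ h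
  have hiso := (traceIsometric_gauge hZ hU hunit).of_isometry hJ hV
  have hcard : Fintype.card (Fin D' × Fin D') ≤ q := by
    rw [Fintype.card_prod, Fintype.card_fin, ← sq]
    exact (Nat.pow_le_pow_left hD' 2).trans hq
  rw [← hiso.rank_mul_rank hZ' (evenTensor_gauge hU') (hirr.gauge hZ'.mul_self) hq1 hcard]
  have hw : ∀ n m, word (gauge p Z U) (N := q) n m = J * word (gauge p Z' U') n m * Jᴴ :=
    word_eq_of_isometry hJ hV hq1
  have hJt : Jᵀ * Jᴴᵀ = 1 := by
    rw [← Matrix.transpose_mul, hJ, Matrix.transpose_one]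
  congr 1
  · rw [← rank_leftMat_mul_mul (K := Jᴴᵀ) (L := Jᵀ) hJt hJt]
    congr 2
    ext1 n; ext1 m
    rw [hw, Matrix.transpose_mul, Matrix.transpose_mul, Matrix.mul_assoc]
  · rw [← rank_leftMat_mul_mul hJ hJ]
    congr 2
    ext1 n; ext1 m
    exact hw n m

lemma blocked_eq_gauge (hZ : Z * Z = 1) (hU : EvenTensor (doubledP p) (doubledT U) Z) (q : ℕ) :
    blocked p U q =
      gauge (fun n : Fin q → ι => ∑ j, p (n j)) Z (word (gauge p Z U) (N := q)) := by
  ext1 n; ext1 m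
  exact blocked_eq hZ hU n m

end Index

lemma eq_and_eq_of_mul_eq_mul {a b x y : ℕ} (ha : a ≤ x) (hb : b ≤ y) (h : a * b = x * y)
    (h0 : 0 < a * b) : a = x ∧ b = y := by
  have hx : 0 < x := (Nat.pos_of_mul_pos_right h0).trans_le ha
  have hy : 0 < y := (Nat.pos_of_mul_pos_left h0).trans_le hb
  constructor <;> nlinarith


/-- Index theory for type I fMPUs with antiperiodic boundary
conditions: after blocking at most `D⁴` times one has `r·ℓ = d^{2q}`, the ranks grow by a
factor of `d` under one more blocking, and the exponentiated index `√(r/ℓ) = r/d^q` is a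
rational number independent of `q`. -/
theorem typeI_index {d D : ℕ} (hd : 1 ≤ d) (hD : 1 ≤ D) (p : Fin d → ZMod 2)
    (Z : Matrix (Fin D) (Fin D) ℂ) (hZ : IsParityMatrix Z)
    (U : Fin d → Fin d → Matrix (Fin D) (Fin D) ℂ)
    (hE : EvenTensor (doubledP p) (doubledT U) Z)
    (hGCF : GCF (doubledP p) (mpoScaled ((Real.sqrt d : ℂ))⁻¹ U) Z)
    (hunit : ∀ N : ℕ, 1 ≤ N → fMPO p U N ∈ Matrix.unitaryGroup (Fin N → Fin d) ℂ) :
    ∃ k : ℕ, k ≤ D ^ 4 ∧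
      (∀ q : ℕ, k ≤ q →
        rrBlocked p U q * llBlocked p U q = d ^ (2 * q) ∧
        rrBlocked p U (q + 1) = d * rrBlocked p U q ∧
        llBlocked p U (q + 1) = d * llBlocked p U q) ∧
      ∃ I : ℚ, ∀ q : ℕ, k ≤ q →
        Real.sqrt ((rrBlocked p U q : ℝ) / (llBlocked p U q : ℝ)) = (I : ℝ) ∧
        (I : ℝ) = (rrBlocked p U q : ℝ) / (d : ℝ) ^ q := by
  have : Nonempty (Fin d) := ⟨⟨0, hd⟩⟩
  have hZZ := hZ.mul_self
  have hl : ∀ q, llBlocked p U q = (leftMat (word (gauge p Z U) (N := q))).rank := fun q => by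
    rw [llBlocked, blocked_eq_gauge hZZ hE, leftRank_gauge hZ]
  have hr : ∀ q, rrBlocked p U q =
      (leftMat fun n k => (word (gauge p Z U) (N := q) n k)ᵀ).rank := fun q => by
    rw [rrBlocked, blocked_eq_gauge hZZ hE,
      rightRank_gauge hZ (evenTensor_word (evenTensor_gauge hE) q)]
  have hmul : ∀ q, D ^ 4 ≤ q → rrBlocked p U q * llBlocked p U q = d ^ (2 * q) := by
    intro q hq
    have hq1 : 1 ≤ q := (Nat.one_le_pow _ _ hD).trans hq
    have hq2 : Fintype.card (Fin D) ^ 2 ≤ q := by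
      rw [Fintype.card_fin]
      exact (Nat.pow_le_pow_right hD (by norm_num)).trans hq
    rw [hl, hr, rank_mul_rank_gauge hZ hE hunit (by simpa using exists_mul_star_eq_inv d) hGCF hq1
      hq2, Fintype.card_fin]
  have hgrow : ∀ q, D ^ 4 ≤ q → rrBlocked p U (q + 1) = d * rrBlocked p U q ∧
      llBlocked p U (q + 1) = d * llBlocked p U q := by
    intro q hq
    refine eq_and_eq_of_mul_eq_mul ?_ ?_ ?_ ?_
    · rw [hr, hr]
      simpa using rank_leftMat_word_transpose_succ_le (gauge p Z U) q
    · rw [hl, hl]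
      simpa using rank_leftMat_word_succ_le (gauge p Z U) q
    · rw [hmul _ (hq.trans q.le_succ), mul_mul_mul_comm, hmul _ hq, Nat.succ_eq_add_one]
      ring
    · rw [hmul _ (hq.trans q.le_succ)]
      positivity
  refine ⟨D ^ 4, le_rfl, fun q hq => ⟨hmul q hq, hgrow q hq⟩,
    (rrBlocked p U (D ^ 4) : ℚ) / (d : ℚ) ^ (D ^ 4), fun q hq => ?_⟩
  have hd0 : (d : ℝ) ≠ 0 := by positivity
  have hI : (((rrBlocked p U (D ^ 4) : ℚ) / (d : ℚ) ^ (D ^ 4) : ℚ) : ℝ) =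
      (rrBlocked p U q : ℝ) / (d : ℝ) ^ q := by
    induction q, hq using Nat.le_induction with
    | base => push_cast; rfl
    | succ q hq ih =>
      rw [ih, (hgrow q hq).1, pow_succ', Nat.cast_mul, mul_div_mul_left _ _ hd0]
  refine ⟨?_, hI⟩
  have hm : (rrBlocked p U q : ℝ) * llBlocked p U q = (d : ℝ) ^ (2 * q) := by
    exact_mod_cast hmul q hq
  have hl0 : (llBlocked p U q : ℝ) ≠ 0 := by
    intro h
    rw [h, mul_zero] at hm
    exact pow_ne_zero _ hd0 hm.symm
  rw [hI, Real.sqrt_eq_iff_mul_self_eq (by positivity) (by positivity), div_mul_div_comm,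
    div_eq_div_iff hl0 (mul_ne_zero (pow_ne_zero _ hd0) (pow_ne_zero _ hd0)), ← pow_add, ← two_mul,
    ← hm]
  ring
end

end FQCA
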